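/- arXiv:2106.06643 — 3 statements merged into one kernel-verified Lean document; each statement's English description precedes it below -/
import Mathlib

section
/- Let K be an algebraically closed field of characteristic 2 and let X = {F = 0} ⊂ ℙ³_K be an irreducible quartic surface with Sing(X) finite, where F(x₁,x₂,x₃,z) = z²·x₁x₂ + B(x₁,x₂,x₃) with B homogeneous of degree 4 (the inseparable case in which the tangent cone at the double point P = [0:0:0:1] consists of two distinct planes). Then |Sing(X)| ≤ 13. -/
open MvPolynomial
noncomputable section

/-- The singular locus of the surface `{F = 0} ⊆ ℙ³_K`: the set of points of `ℙ³_K` at which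
`F` and all four partial derivatives of `F` vanish (tested on every representative vector). -/
def singLocus {K : Type*} [Field K] (F : MvPolynomial (Fin 4) K) :
    Set (Projectivization K (Fin 4 → K)) :=
  {p | ∀ (v : Fin 4 → K) (hv : v ≠ 0), Projectivization.mk K v hv = p →
      (eval v F = 0 ∧ ∀ i, eval v (pderiv i F) = 0)}


lemma finrank_hom (K : Type*) [Field K] (d : ℕ) :
    Module.finrank K (homogeneousSubmodule (Fin 3) K d) = (d + 2).choose 2 := by
  rw [homogeneousSubmodule_eq_finsupp_supported]
  rw [(AddMonoidAlgebra.supportedEquivFinsupp _).finrank_eq]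
  have h : {e : Fin 3 →₀ ℕ | e.degree = d} = ↑(Finset.finsuppAntidiag (Finset.univ : Finset (Fin 3)) d) := by
    ext e
    simp [Finset.mem_finsuppAntidiag, Finsupp.degree_eq_sum]
  rw [h]
  rw [Module.finrank_finsupp_self]
  simp only [Finset.coe_sort_coe, Fintype.card_coe]
  rw [Finset.card_finsuppAntidiag_nat_eq_choose]
  simp
  rw [show 2 + d = d + 2 by ring]
  exact Nat.choose_symm_of_eq_add rfl

instance finite_hom (K : Type*) [Field K] (d : ℕ) :
    Module.Finite K (homogeneousSubmodule (Fin 3) K d) := 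
  Module.finite_of_finrank_pos (by rw [finrank_hom]; exact Nat.choose_pos (by omega))

lemma hom_cofactor {K : Type*} [Field K] {g c : MvPolynomial (Fin 3) K} {i j : ℕ}
    (hg : g.IsHomogeneous i) (hg0 : g ≠ 0) (h : (g * c).IsHomogeneous (i + j)) :
    c.IsHomogeneous j := by
  have : GradedAlgebra (homogeneousSubmodule (Fin 3) K) := MvPolynomial.gradedAlgebra
  have h1 := DirectSum.coe_decompose_mul_add_of_left_mem (homogeneousSubmodule (Fin 3) K)
    (i := i) (j := j) (a := g) (b := c) hg
  have h2 := DirectSum.decompose_of_mem_same (homogeneousSubmodule (Fin 3) K) 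
    (x := g * c) (i := i+j) h
  rw [h2] at h1
  have := mul_left_cancel₀ hg0 h1
  rw [this]
  exact (DirectSum.decompose (homogeneousSubmodule (Fin 3) K) c j).2

lemma exists_linform {K : Type*} [Field K] (p q : Fin 3 → K) (hq : q ≠ 0)
    (h : ∀ c : K, p ≠ c • q) : ∃ l : MvPolynomial (Fin 3) K, l.IsHomogeneous 1 ∧
      eval q l = 0 ∧ eval p l ≠ 0 := by
  obtain ⟨a, ha⟩ := Function.ne_iff.mp hq
  have hne : p ≠ (p a / q a) • q := h _
  obtain ⟨b, hb⟩ := Function.ne_iff.mp hne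
  simp only [Pi.zero_apply] at ha
  refine ⟨C (q a) * X b - C (q b) * X a, ?_, ?_, ?_⟩
  · exact (isHomogeneous_C_mul_X _ _).sub (isHomogeneous_C_mul_X _ _)
  · simp; ring
  · simp
    intro h
    apply hb
    simp
    field_simp
    linear_combination h

abbrev HS (K : Type*) [Field K] (d : ℕ) := homogeneousSubmodule (Fin 3) K d

lemma bezout34 {K : Type*} [Field K] (f g : MvPolynomial (Fin 3) K) (hf : f.IsHomogeneous 3)
    (hg : g.IsHomogeneous 4) (hg0 : g ≠ 0) (hrel : IsRelPrime f g)
    (p : Fin 13 → Fin 3 → K) (hp0 : ∀ i, p i ≠ 0) (hp : ∀ i j, ∀ c : K, p i = c • p j → i = j)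
    (hpf : ∀ i, eval (p i) f = 0) (hpg : ∀ i, eval (p i) g = 0) : False := by
  classical
  have hl : ∀ i j : Fin 13, ∃ l : MvPolynomial (Fin 3) K, l.IsHomogeneous 1 ∧
      (i ≠ j → eval (p j) l = 0 ∧ eval (p i) l ≠ 0) := by
    intro i j
    by_cases hij : i = j
    · exact ⟨0, isHomogeneous_zero _ _ _, fun h => (h hij).elim⟩
    · obtain ⟨l, h1, h2, h3⟩ := exists_linform (p i) (p j) (hp0 j) (fun c hc => hij (hp i j c hc))
      exact ⟨l, h1, fun _ => ⟨h2, h3⟩⟩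
  choose l hl1 hl2 using hl
  let Q : Fin 13 → MvPolynomial (Fin 3) K := fun i => ∏ j ∈ Finset.univ.erase i, l i j
  have hQ : ∀ i, Q i ∈ HS K 12 := by
    intro i
    have := IsHomogeneous.prod (Finset.univ.erase i) (fun j => l i j) (fun _ => 1) (fun j _ => hl1 i j)
    simp only [Finset.sum_const, Finset.card_erase_of_mem (Finset.mem_univ i), Finset.card_univ, Fintype.card_fin, smul_eq_mul] at this
    exact this
  have hQ1 : ∀ i, eval (p i) (Q i) ≠ 0 := by
    intro i
    simp only [Q, map_prod]
    exact Finset.prod_ne_zero_iff.mpr fun j hj => (hl2 i j (Finset.ne_of_mem_erase hj).symm).2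
  have hQ2 : ∀ i j, i ≠ j → eval (p j) (Q i) = 0 := by
    intro i j hij
    simp only [Q, map_prod]
    exact Finset.prod_eq_zero (Finset.mem_erase.mpr ⟨hij.symm, Finset.mem_univ j⟩) (hl2 i j hij).1
  let ev : HS K 12 →ₗ[K] (Fin 13 → K) :=
    LinearMap.pi fun i => (MvPolynomial.aeval (p i)).toLinearMap ∘ₗ (HS K 12).subtype
  have hev : ∀ (a : HS K 12) i, ev a i = eval (p i) a.1 := by
    intro a i
    simp [ev, MvPolynomial.aeval_eq_eval]
  have hsurj : LinearMap.range ev = ⊤ := by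
    rw [LinearMap.range_eq_top]
    intro y
    refine ⟨∑ i, (y i / eval (p i) (Q i)) • ⟨Q i, hQ i⟩, ?_⟩
    ext j
    rw [map_sum, Finset.sum_apply, Finset.sum_eq_single j]
    · rw [map_smul, Pi.smul_apply, hev, smul_eq_mul]
      exact div_mul_cancel₀ _ (hQ1 j)
    · intro i _ hij
      rw [map_smul, Pi.smul_apply, hev, smul_eq_mul, hQ2 i j hij, mul_zero]
    · simp
  let m1 : HS K 9 →ₗ[K] HS K 12 := LinearMap.codRestrict _ (LinearMap.mulLeft K f ∘ₗ (HS K 9).subtype)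
    (fun c => (hf.mul c.2 : (f * c.1).IsHomogeneous (3 + 9)))
  let m2 : HS K 8 →ₗ[K] HS K 12 := LinearMap.codRestrict _ (LinearMap.mulLeft K g ∘ₗ (HS K 8).subtype)
    (fun c => (hg.mul c.2 : (g * c.1).IsHomogeneous (4 + 8)))
  let n1 : HS K 5 →ₗ[K] HS K 9 := LinearMap.codRestrict _ (LinearMap.mulLeft K g ∘ₗ (HS K 5).subtype)
    (fun c => (hg.mul c.2 : (g * c.1).IsHomogeneous (4 + 5)))
  let n2 : HS K 5 →ₗ[K] HS K 8 := LinearMap.codRestrict _ (LinearMap.mulLeft K f ∘ₗ (HS K 5).subtype)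
    (fun c => (hf.mul c.2 : (f * c.1).IsHomogeneous (3 + 5)))
  have hm1 : ∀ c, (m1 c).1 = f * c.1 := fun _ => rfl
  have hm2 : ∀ c, (m2 c).1 = g * c.1 := fun _ => rfl
  have hn1 : ∀ c, (n1 c).1 = g * c.1 := fun _ => rfl
  have hn2 : ∀ c, (n2 c).1 = f * c.1 := fun _ => rfl
  let φ : (HS K 9 × HS K 8) →ₗ[K] HS K 12 := m1.coprod m2
  let ψ : HS K 5 →ₗ[K] (HS K 9 × HS K 8) := n1.prod (-n2)
  have hker : LinearMap.ker φ ≤ LinearMap.range ψ := by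
    rintro ⟨⟨a, ha⟩, ⟨b, hb⟩⟩ hab
    have hab' : f * a + g * b = 0 := by
      have := congrArg Subtype.val (LinearMap.mem_ker.mp hab)
      simpa [φ, hm1, hm2] using this
    have hd : g ∣ a := by
      refine hrel.symm.dvd_of_dvd_mul_left (⟨-b, ?_⟩ : g ∣ f * a)
      linear_combination hab'
    obtain ⟨c, rfl⟩ := hd
    have hc : c.IsHomogeneous 5 := hom_cofactor hg hg0 ha
    refine ⟨⟨c, hc⟩, ?_⟩
    have hb' : b = - (f * c) := by
      apply mul_left_cancel₀ hg0
      linear_combination hab'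
    ext : 2
    · simp [ψ, hn1]
    · simp [ψ, hn2, hb']
  have hle : LinearMap.range φ ≤ LinearMap.ker ev := by
    rintro _ ⟨⟨a, b⟩, rfl⟩
    rw [LinearMap.mem_ker]
    ext i
    rw [hev]
    simp [φ, hm1, hm2, hpf, hpg]
  have e1 := LinearMap.finrank_range_add_finrank_ker φ
  have e2 := LinearMap.finrank_range_add_finrank_ker ev
  have e3 := Submodule.finrank_mono hker
  have e4 := Submodule.finrank_mono hle
  have e5 := LinearMap.finrank_range_le ψ
  rw [hsurj, finrank_top] at e2
  rw [Module.finrank_prod] at e1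
  simp only [finrank_hom, Module.finrank_fin_fun] at e1 e2 e5
  norm_num [Nat.choose] at e1 e2 e5
  omega

lemma line_poly {K : Type*} [Field K] (h : MvPolynomial (Fin 3) K) (e : ℕ)
    (he : h.totalDegree ≤ e) (q r : Fin 3 → K) :
    ∃ P : Polynomial K, (∀ s, P.eval s = eval (s • q + r) h) ∧
      P.coeff e = eval q (homogeneousComponent e h) := by
  let L : Fin 3 → Polynomial K := fun i => Polynomial.C (q i) * Polynomial.X + Polynomial.C (r i)
  have hL : ∀ i, (L i).natDegree ≤ 1 := fun i => Polynomial.natDegree_linear_le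
  have hL1 : ∀ i, (L i).coeff 1 = q i := fun i => by simp [L]
  refine ⟨MvPolynomial.eval₂ Polynomial.C L h, ?_, ?_⟩
  · intro s
    rw [MvPolynomial.eval₂_eq', MvPolynomial.eval_eq', Polynomial.eval_finsetSum]
    simp only [Polynomial.eval_mul, Polynomial.eval_C, Polynomial.eval_prod, Polynomial.eval_pow, L,
      Polynomial.eval_add, Polynomial.eval_X, Pi.add_apply, Pi.smul_apply, smul_eq_mul]
    simp only [mul_comm s]
  · rw [MvPolynomial.eval₂_eq', homogeneousComponent_apply, map_sum, Polynomial.finsetSum_coeff,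
      Finset.sum_filter]
    refine Finset.sum_congr rfl fun d hd => ?_
    rw [Polynomial.coeff_C_mul]
    have hdeg : d.degree = d 0 + d 1 + d 2 := by
      rw [Finsupp.degree_eq_sum, Fin.sum_univ_three]
    have hp : ∀ i, (L i ^ d i).natDegree ≤ d i := fun i => by
      simpa using Polynomial.natDegree_pow_le_of_le (d i) (hL i)
    have hc : ∀ i, (L i ^ d i).coeff (d i) = q i ^ d i := fun i => by
      have := Polynomial.coeff_pow_of_natDegree_le (m := d i) (hL i)
      rwa [mul_one, hL1] at this
    have hp01 : (L 0 ^ d 0 * L 1 ^ d 1).natDegree ≤ d 0 + d 1 :=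
      Polynomial.natDegree_mul_le_of_le (hp 0) (hp 1)
    have hp012 : (L 0 ^ d 0 * L 1 ^ d 1 * L 2 ^ d 2).natDegree ≤ d 0 + d 1 + d 2 :=
      Polynomial.natDegree_mul_le_of_le hp01 (hp 2)
    rw [Fin.prod_univ_three]
    split_ifs with hde
    · rw [← hde, hdeg, Polynomial.coeff_mul_add_eq_of_natDegree_le hp01 (hp 2),
        Polynomial.coeff_mul_add_eq_of_natDegree_le (hp 0) (hp 1), hc, hc, hc,
        MvPolynomial.eval_monomial, Finsupp.prod_fintype _ _ (by simp), Fin.prod_univ_three]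
    · have : d.degree ≤ e := le_trans (by
        have := MvPolynomial.le_totalDegree hd
        rwa [Finsupp.degree_eq_sum, ← Finsupp.sum_fintype d (fun _ n => n) (by simp)]) he
      rw [Polynomial.coeff_eq_zero_of_natDegree_lt (by omega), mul_zero]

/-- A nonconstant polynomial in three variables has infinitely many pairwise
nonproportional zeros. -/
lemma many_zeros {K : Type*} [Field K] [IsAlgClosed K] (h : MvPolynomial (Fin 3) K)
    (h0 : h ≠ 0) (hu : ¬ IsUnit h) :
    ∃ w : K → Fin 3 → K, (∀ t, eval (w t) h = 0) ∧ (∀ t, w t ≠ 0) ∧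
      ∀ t t' (c : K), w t = c • w t' → t = t' := by
  have : Infinite K := IsAlgClosed.instInfinite
  set e := h.totalDegree with he
  have he0 : e ≠ 0 := by
    intro h1
    obtain ⟨a, ha⟩ : ∃ a, h = C a := ⟨_, totalDegree_eq_zero_iff_eq_C.mp (he ▸ h1)⟩
    apply hu
    rw [ha]
    refine IsUnit.map C (IsUnit.mk0 a ?_)
    rintro rfl
    exact h0 (by simpa using ha)
  have htop : homogeneousComponent e h ≠ 0 := by
    intro h1
    obtain ⟨d, hd, hde⟩ := Finset.exists_mem_eq_sup h.support (support_nonempty.mpr h0)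
      (fun s => s.sum fun _ n => n)
    have h2 := congrArg (coeff d) h1
    rw [coeff_homogeneousComponent, if_pos, coeff_zero] at h2
    · exact (mem_support_iff.mp hd) h2
    · rw [he, totalDegree, hde]
      rfl
  obtain ⟨q, hq⟩ : ∃ q, eval q (homogeneousComponent e h) ≠ 0 := by
    by_contra! hcon
    exact htop (MvPolynomial.funext fun q => by simpa using hcon q)
  have hq0 : q ≠ 0 := by
    rintro rfl
    apply hq
    have := (homogeneousComponent_isHomogeneous e h).coeff_eq_zero (d := 0) (by simpa using he0.symm)
    simpa [MvPolynomial.constantCoeff_eq] using this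
  obtain ⟨i, hi⟩ := Function.ne_iff.mp hq0
  obtain ⟨j, k, hij, hik, hjk⟩ : ∃ j k : Fin 3, i ≠ j ∧ i ≠ k ∧ j ≠ k := by
    have hall : ∀ i : Fin 3, ∃ j k : Fin 3, i ≠ j ∧ i ≠ k ∧ j ≠ k := by decide
    exact hall i
  have hs : ∀ t : K, ∃ s : K, eval (s • q + (Pi.single j 1 + t • Pi.single k 1)) h = 0 := by
    intro t
    obtain ⟨P, hP1, hP2⟩ := line_poly h e le_rfl q (Pi.single j 1 + t • Pi.single k 1)
    obtain ⟨s, hs⟩ := IsAlgClosed.exists_root P (by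
      intro hdeg
      rw [← hP2] at hq
      have := Polynomial.le_natDegree_of_ne_zero hq
      have : P.natDegree = 0 := Polynomial.natDegree_eq_of_degree_eq_some hdeg
      omega)
    exact ⟨s, by rw [← hP1]; exact hs⟩
  choose s hs using hs
  let w : K → Fin 3 → K := fun t => s t • q + (Pi.single j 1 + t • Pi.single k 1)
  have hwi : ∀ t, w t i = s t * q i := fun t => by simp [w, hij, hik]
  have hwj : ∀ t, w t j = s t * q j + 1 := fun t => by simp [w, hjk]
  have hwk : ∀ t, w t k = s t * q k + t := fun t => by simp [w, hjk.symm]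
  simp only [Pi.zero_apply] at hi
  have key : ∀ t t' (c : K), w t = c • w t' → c = 1 ∧ t = c * t' := by
    intro t t' c hc
    have a1 := congrFun hc i
    have a2 := congrFun hc j
    have a3 := congrFun hc k
    simp only [Pi.smul_apply, smul_eq_mul, hwi, hwj, hwk] at a1 a2 a3
    have a4 : s t = c * s t' := mul_right_cancel₀ hi (by linear_combination a1)
    rw [a4] at a2 a3
    constructor
    · linear_combination -a2
    · linear_combination a3
  refine ⟨w, hs, ?_, ?_⟩
  · intro t ht
    have := (key t t 0 (by simpa using ht)).1
    exact zero_ne_one this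
  · intro t t' c hc
    obtain ⟨h1, h2⟩ := key t t' c hc
    simpa [h1] using h2

/-- The singularity conditions for `F` at a vector `v`, made explicit. -/
lemma sing_iff {K : Type*} [Field K] [CharP K 2]
    (B : MvPolynomial (Fin 3) K) (F : MvPolynomial (Fin 4) K)
    (hF : F = X 3 ^ 2 * (X 0 * X 1) + rename (Fin.castLE (by norm_num : (3:ℕ) ≤ 4)) B)
    (v : Fin 4 → K) (u : Fin 3 → K) (hu : u = ![v 0, v 1, v 2]) :
    (eval v F = 0 ∧ ∀ i, eval v (pderiv i F) = 0) ↔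
      (v 3 ^ 2 * (v 0 * v 1) + eval u B = 0 ∧ v 3 ^ 2 * v 1 + eval u (pderiv 0 B) = 0 ∧
        v 3 ^ 2 * v 0 + eval u (pderiv 1 B) = 0 ∧ eval u (pderiv 2 B) = 0) := by
  set ι : Fin 3 → Fin 4 := Fin.castLE (by norm_num : (3:ℕ) ≤ 4) with hι
  have hinj : Function.Injective ι := Fin.castLE_injective _
  have hvu : v ∘ ι = u := by
    rw [hu]; ext i; fin_cases i <;> rfl
  have e0 : pderiv 0 (rename ι B) = rename ι (pderiv 0 B) := pderiv_rename hinj 0 B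
  have e1 : pderiv 1 (rename ι B) = rename ι (pderiv 1 B) := pderiv_rename hinj 1 B
  have e2 : pderiv 2 (rename ι B) = rename ι (pderiv 2 B) := pderiv_rename hinj 2 B
  have e3 : pderiv 3 (rename ι B) = 0 := by
    apply pderiv_eq_zero_of_notMem_vars
    intro h
    have := vars_rename ι B h
    obtain ⟨j, _, hj⟩ := Finset.mem_image.mp this
    revert hj
    fin_cases j <;> decide
  have h2 : (2 : K) = 0 := CharTwo.two_eq_zero
  rw [Fin.forall_fin_succ, Fin.forall_fin_succ, Fin.forall_fin_succ, Fin.forall_fin_succ]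
  have f0 : eval v F = v 3 ^ 2 * (v 0 * v 1) + eval u B := by
    rw [hF]; simp [eval_rename, hvu]
  have f1 : eval v (pderiv 0 F) = v 3 ^ 2 * v 1 + eval u (pderiv 0 B) := by
    rw [hF, map_add, e0]; simp [eval_rename, hvu, Derivation.leibniz, pderiv_X]
  have f2 : eval v (pderiv 1 F) = v 3 ^ 2 * v 0 + eval u (pderiv 1 B) := by
    rw [hF, map_add, e1]; simp [eval_rename, hvu, Derivation.leibniz, pderiv_X]
  have f3 : eval v (pderiv 2 F) = eval u (pderiv 2 B) := by
    rw [hF, map_add, e2]; simp [eval_rename, hvu, Derivation.leibniz, pderiv_X]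
  have f4 : eval v (pderiv 3 F) = 0 := by
    rw [hF, map_add, e3]; simp [Derivation.leibniz, pderiv_X, h2]
  change (eval v F = 0 ∧ eval v (pderiv 0 F) = 0 ∧ eval v (pderiv 1 F) = 0 ∧
    eval v (pderiv 2 F) = 0 ∧ eval v (pderiv 3 F) = 0 ∧ _) ↔ _
  rw [f0, f1, f2, f3, f4]
  simp

lemma eval_smul_hom {σ K : Type*} [Field K] {f : MvPolynomial σ K} {n : ℕ}
    (hf : f.IsHomogeneous n) (c : K) (v : σ → K) : eval (c • v) f = c ^ n * eval v f := by
  classical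
  rw [eval_eq, eval_eq, Finset.mul_sum]
  refine Finset.sum_congr rfl fun d hd => ?_
  have : d.degree = n := by
    by_contra h
    exact (mem_support_iff.mp hd) (hf.coeff_eq_zero h)
  simp only [Pi.smul_apply, smul_eq_mul, mul_pow, Finset.prod_mul_distrib, Finset.prod_pow_eq_pow_sum]
  rw [← this, Finsupp.degree_apply]
  ring

lemma mk_mem_singLocus {K : Type*} [Field K] (F : MvPolynomial (Fin 4) K)
    (hFh : F.IsHomogeneous 4) (v : Fin 4 → K) (hv : v ≠ 0)
    (h : eval v F = 0 ∧ ∀ i, eval v (pderiv i F) = 0) :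
    Projectivization.mk K v hv ∈ singLocus F := by
  intro v' hv' he
  rw [Projectivization.mk_eq_mk_iff'] at he
  obtain ⟨c, rfl⟩ := he
  refine ⟨by rw [eval_smul_hom hFh, h.1, mul_zero], fun i => ?_⟩
  rw [eval_smul_hom hFh.pderiv, h.2 i, mul_zero]

/-- Inseparable case with tangent cone two distinct planes: `F = z²x₁x₂ + B(x₁,x₂,x₃)`, `X`
irreducible with finite singular locus, over an algebraically closed field of characteristic 2.
Then `|Sing(X)| ≤ 13`. -/
theorem inseparable_two_planes_singular_count_le_thirteen
    {K : Type*} [Field K] [IsAlgClosed K] [CharP K 2]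
    (B : MvPolynomial (Fin 3) K) (hBhom : B.IsHomogeneous 4)
    (F : MvPolynomial (Fin 4) K)
    (hF : F = X 3 ^ 2 * (X 0 * X 1) + rename (Fin.castLE (by norm_num : (3:ℕ) ≤ 4)) B)
    (hFirr : Irreducible F) (hfin : (singLocus F).Finite) :
    (singLocus F).ncard ≤ 13 := by
  classical
  have hKinf : Infinite K := IsAlgClosed.instInfinite
  have h2 : (2 : K) = 0 := CharTwo.two_eq_zero
  have hFh : F.IsHomogeneous 4 := by
    rw [hF]
    refine IsHomogeneous.add ?_ hBhom.rename_isHomogeneous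
    exact (isHomogeneous_X_pow 3 2).mul ((isHomogeneous_X K 0).mul (isHomogeneous_X K 1))
  have euler : ∀ u : Fin 3 → K, u 0 * eval u (pderiv 0 B) + u 1 * eval u (pderiv 1 B) +
      u 2 * eval u (pderiv 2 B) = 0 := by
    intro u
    have := congrArg (eval u) hBhom.sum_X_mul_pderiv
    rw [Fin.sum_univ_three] at this
    simp only [map_add, map_mul, eval_X, map_nsmul] at this
    rw [this, nsmul_eq_mul]
    push_cast
    linear_combination 2 * eval u B * h2
  have hfg : ∃ f g : MvPolynomial (Fin 3) K, f = pderiv 2 B ∧ g = X 0 * pderiv 0 B + B := ⟨_, _, rfl, rfl⟩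
  obtain ⟨f, g, hf, hg⟩ := hfg
  have hfh : f.IsHomogeneous 3 := hf ▸ hBhom.pderiv
  have hgh : g.IsHomogeneous 4 := by
    rw [hg]
    exact IsHomogeneous.add ((isHomogeneous_X K 0).mul (hBhom.pderiv (i := 0))) hBhom
  -- lifting common zeros to singular points
  have lift : ∀ u : Fin 3 → K, (u 0 ≠ 0 ∨ u 1 ≠ 0) → eval u f = 0 → eval u g = 0 →
      ∃ z : K, ∃ hv : ![u 0, u 1, u 2, z] ≠ 0,
        Projectivization.mk K ![u 0, u 1, u 2, z] hv ∈ singLocus F := by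
    intro u hu0 huf hug
    have hne : ∀ z : K, ![u 0, u 1, u 2, z] ≠ 0 := by
      intro z hz
      have a0 := congrFun hz 0
      have a1 := congrFun hz 1
      simp at a0 a1
      tauto
    rw [hf] at huf
    rw [hg] at hug
    simp only [map_add, map_mul, eval_X] at hug
    have eu := euler u
    rw [huf, mul_zero, add_zero] at eu
    have hu' : u = ![u 0, u 1, u 2] := by ext i; fin_cases i <;> rfl
    have : ∃ z : K, z ^ 2 * (u 0 * u 1) + eval u B = 0 ∧ z ^ 2 * u 1 + eval u (pderiv 0 B) = 0 ∧
        z ^ 2 * u 0 + eval u (pderiv 1 B) = 0 := by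
      by_cases h1 : u 1 = 0
      · have h0 : u 0 ≠ 0 := by tauto
        obtain ⟨z, hz⟩ := IsAlgClosed.exists_pow_nat_eq (- eval u (pderiv 1 B) / u 0) (n := 2) (by norm_num)
        have hz' : z ^ 2 * u 0 = - eval u (pderiv 1 B) := by rw [hz]; field_simp
        have hB0 : eval u (pderiv 0 B) = 0 := by
          rw [h1, zero_mul, add_zero] at eu
          exact (mul_eq_zero.mp eu).resolve_left h0
        rw [hB0] at hug ⊢
        refine ⟨z, ?_, ?_, ?_⟩
        · rw [h1]; linear_combination hug
        · rw [h1]; ring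
        · rw [hz']; ring
      · obtain ⟨z, hz⟩ := IsAlgClosed.exists_pow_nat_eq (- eval u (pderiv 0 B) / u 1) (n := 2) (by norm_num)
        have hz' : z ^ 2 * u 1 = - eval u (pderiv 0 B) := by rw [hz]; field_simp
        refine ⟨z, ?_, ?_, ?_⟩
        · linear_combination u 0 * hz' + hug - u 0 * eval u (pderiv 0 B) * h2
        · rw [hz']; ring
        · apply mul_left_cancel₀ h1
          linear_combination u 0 * hz' + eu - u 0 * eval u (pderiv 0 B) * h2
    obtain ⟨z, hz0, hz1, hz2⟩ := this
    refine ⟨z, hne z, mk_mem_singLocus F hFh _ _ ?_⟩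
    rw [sing_iff B F hF _ u hu']
    exact ⟨hz0, hz1, hz2, huf⟩
  -- no common component
  have nocommon : ∀ h : MvPolynomial (Fin 3) K, h ≠ 0 → ¬ IsUnit h → h ∣ f → h ∣ g → False := by
    intro h h0 hu h1 h2
    obtain ⟨w, hw, hw0, hwp⟩ := many_zeros h h0 hu
    have hwf : ∀ t, eval (w t) f = 0 := fun t => by
      obtain ⟨c, rfl⟩ := h1
      rw [map_mul, hw, zero_mul]
    have hwg : ∀ t, eval (w t) g = 0 := fun t => by
      obtain ⟨c, rfl⟩ := h2
      rw [map_mul, hw, zero_mul]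
    have hbad : {t | ¬ (w t 0 ≠ 0 ∨ w t 1 ≠ 0)}.Subsingleton := by
      intro t ht t' ht'
      simp only [Set.mem_ofPred_eq, not_or, not_not] at ht ht'
      have h2' : w t' 2 ≠ 0 := by
        intro h2'
        apply hw0 t'
        ext i
        fin_cases i
        · exact ht'.1
        · exact ht'.2
        · exact h2'
      apply hwp t t' (w t 2 / w t' 2)
      ext i
      fin_cases i
      · simp [ht.1, ht'.1]
      · simp [ht.2, ht'.2]
      · simp; field_simp
    have hgood : {t | w t 0 ≠ 0 ∨ w t 1 ≠ 0}.Infinite := by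
      have := hbad.finite.infinite_compl
      convert this using 1
      ext t; simp only [Set.mem_compl_iff, Set.mem_ofPred_eq, not_not]
    choose z hv hz using fun t : {t | w t 0 ≠ 0 ∨ w t 1 ≠ 0} => lift (w t) t.2 (hwf t) (hwg t)
    have := hgood.to_subtype
    refine Set.infinite_of_injective_forall_mem (f := fun t => Projectivization.mk K _ (hv t)) ?_ hz hfin
    intro t t' htt
    simp only at htt
    rw [Projectivization.mk_eq_mk_iff'] at htt
    obtain ⟨c, hc⟩ := htt
    apply Subtype.ext
    apply hwp t t' c
    ext i
    fin_cases i
    · exact (congrFun hc 0).symm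
    · exact (congrFun hc 1).symm
    · exact (congrFun hc 2).symm
  have hrel : IsRelPrime f g := by
    intro h h1 h2
    by_contra hu
    by_cases h0 : h = 0
    · subst h0
      rw [zero_dvd_iff] at h1 h2
      refine nocommon (X 0) (X_ne_zero 0) ?_ (h1 ▸ dvd_zero _) (h2 ▸ dvd_zero _)
      intro hX
      have := hX.map (eval (0 : Fin 3 → K))
      simp at this
    · exact nocommon h h0 hu h1 h2
  have hg0 : g ≠ 0 := by
    rintro h0
    rw [h0, isRelPrime_zero_right] at hrel
    have := hrel.map (eval (0 : Fin 3 → K))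
    have h3 := eval_smul_hom hfh 0 (0 : Fin 3 → K)
    rw [zero_smul] at h3
    rw [h3] at this
    simp at this
  by_contra hcon
  push Not at hcon
  have hP : ((0 : Fin 4 → K) 0 : K) = 0 := rfl
  have hpne : (![0, 0, 0, 1] : Fin 4 → K) ≠ 0 := fun h => by
    have := congrFun h 3
    simp at this
  set P : Projectivization K (Fin 4 → K) := Projectivization.mk K ![0, 0, 0, 1] hpne with hPdef
  have hcard : 13 ≤ (singLocus F \ {P}).ncard := by
    have := Set.ncard_le_ncard_sdiff_add_ncard (singLocus F) {P} 
    rw [Set.ncard_singleton] at this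
    omega
  obtain ⟨T, hTs, hT⟩ := Set.exists_subset_card_eq hcard
  have hTfin : T.Finite := hfin.subset (hTs.trans Set.sdiff_subset)
  have : Finite T := hTfin
  let en : Fin 13 ≃ T := (Finite.equivFinOfCardEq (by rw [Nat.card_coe_set_eq, hT])).symm
  let V : Fin 13 → Fin 4 → K := fun i => (en i).1.rep
  have hV0 : ∀ i, V i ≠ 0 := fun i => (en i).1.rep_nonzero
  have hVmk : ∀ i, Projectivization.mk K (V i) (hV0 i) = (en i).1 := fun i => (en i).1.mk_rep
  let p : Fin 13 → Fin 3 → K := fun i => ![V i 0, V i 1, V i 2]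
  have hsing : ∀ i, V i 3 ^ 2 * (V i 0 * V i 1) + eval (p i) B = 0 ∧
      V i 3 ^ 2 * V i 1 + eval (p i) (pderiv 0 B) = 0 ∧
      V i 3 ^ 2 * V i 0 + eval (p i) (pderiv 1 B) = 0 ∧ eval (p i) (pderiv 2 B) = 0 := by
    intro i
    rw [← sing_iff B F hF (V i) (p i) rfl]
    exact (hTs (en i).2).1 (V i) (hV0 i) (hVmk i)
  have hp0 : ∀ i, p i ≠ 0 := by
    intro i hi
    have a0 : V i 0 = 0 := congrFun hi 0
    have a1 : V i 1 = 0 := congrFun hi 1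
    have a2 : V i 2 = 0 := congrFun hi 2
    apply (hTs (en i).2).2
    rw [Set.mem_singleton_iff, ← hVmk, hPdef, Projectivization.mk_eq_mk_iff']
    refine ⟨V i 3, ?_⟩
    ext j
    fin_cases j <;> simp [a0, a1, a2]
  have hpf : ∀ i, eval (p i) f = 0 := fun i => hf ▸ (hsing i).2.2.2
  have hpg : ∀ i, eval (p i) g = 0 := by
    intro i
    obtain ⟨s0, s1, -, -⟩ := hsing i
    rw [hg]
    simp only [map_add, map_mul, eval_X]
    have : p i 0 = V i 0 := rfl
    rw [this]
    linear_combination s0 + V i 0 * s1 - V i 3 ^ 2 * V i 0 * V i 1 * h2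
  -- no singular point projects to `[0:0:1]`
  have hnot : ∀ i, V i 0 ≠ 0 ∨ V i 1 ≠ 0 := by
    intro i
    by_contra hc
    push Not at hc
    obtain ⟨c0, c1⟩ := hc
    obtain ⟨s0, s1, s2, s3⟩ := hsing i
    simp only [c0, c1, mul_zero, zero_add] at s0 s1 s2
    have c2 : V i 2 ≠ 0 := by
      intro c2
      apply hp0 i
      ext j; fin_cases j <;> simp [p, c0, c1, c2]
    have hne : ∀ z : K, ![0, 0, V i 2, z] ≠ 0 := fun z h => by
      have := congrFun h 2
      simp at this
      exact c2 this
    refine Set.infinite_of_injective_forall_mem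
      (f := fun z : K => Projectivization.mk K ![0, 0, V i 2, z] (hne z)) ?_ ?_ hfin
    · intro z z' hzz
      simp only at hzz
      rw [Projectivization.mk_eq_mk_iff'] at hzz
      obtain ⟨c, hc⟩ := hzz
      have b2 : c * V i 2 = V i 2 := congrFun hc 2
      have b3 : c * z' = z := congrFun hc 3
      have : c = 1 := mul_right_cancel₀ c2 (by rw [b2, one_mul])
      rw [← b3, this, one_mul]
    · intro z
      apply mk_mem_singLocus F hFh
      rw [sing_iff B F hF _ (p i) (by simp [p, c0, c1])]
      simp [s0, s1, s2, s3]
  refine bezout34 f g hfh hgh hg0 hrel p hp0 ?_ hpf hpg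
  intro i j c hc
  have d0 : V i 0 = c * V j 0 := congrFun hc 0
  have d1 : V i 1 = c * V j 1 := congrFun hc 1
  have d2 : V i 2 = c * V j 2 := congrFun hc 2
  have hsq : V i 3 ^ 2 = (c * V j 3) ^ 2 := by
    obtain ⟨-, i1, i2, -⟩ := hsing i
    obtain ⟨-, j1, j2, -⟩ := hsing j
    rw [hc, eval_smul_hom hBhom.pderiv] at i1 i2
    norm_num at i1 i2
    rcases hnot i with h | h
    · apply mul_right_cancel₀ h
      linear_combination i2 - c ^ 3 * j2 - c ^ 2 * V j 3 ^ 2 * d0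
    · apply mul_right_cancel₀ h
      linear_combination i1 - c ^ 3 * j1 - c ^ 2 * V j 3 ^ 2 * d1
  have d3 : V i 3 = c * V j 3 := by
    have : (V i 3 - c * V j 3) ^ 2 = 0 := by
      linear_combination hsq + (c ^ 2 * V j 3 ^ 2 - V i 3 * c * V j 3) * h2
    exact sub_eq_zero.mp (pow_eq_zero_iff (two_ne_zero) |>.mp this)
  apply en.injective
  apply Subtype.ext
  rw [← hVmk, ← hVmk, Projectivization.mk_eq_mk_iff']
  refine ⟨c, ?_⟩
  ext k
  fin_cases k
  · exact d0.symm
  · exact d1.symm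
  · exact d2.symm
  · exact d3.symm

end
end

section
/- Let K be an algebraically closed field of characteristic 2 and let B ∈ K[x₁,x₂,x₃] be a homogeneous polynomial of degree 4. If the set 𝒞_B := {[x] ∈ ℙ²_K : ∂B/∂x₁(x) = ∂B/∂x₂(x) = ∂B/∂x₃(x) = 0} is finite, then |𝒞_B| ≤ 7. -/
open MvPolynomial

noncomputable section

/-- The critical locus of a homogeneous polynomial `g ∈ K[x₁,x₂,x₃]` in `ℙ²_K`: the points at
which all three partial derivatives of `g` vanish (tested on every representative vector). -/
def critLocus {K : Type*} [Field K] (g : MvPolynomial (Fin 3) K) :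
    Set (Projectivization K (Fin 3 → K)) :=
  {p | ∀ (v : Fin 3 → K) (hv : v ≠ 0), Projectivization.mk K v hv = p →
      ∀ i, eval v (pderiv i g) = 0}

/-- The Frobenius-semilinear map `v ↦ M (v₀², v₁², v₂²)`. -/
def sqMap {K : Type*} [Field K] (M : Fin 3 → Fin 3 → K) (v : Fin 3 → K) : Fin 3 → K :=
  fun i => ∑ j, M i j * v j ^ 2

/-- The gradient of `B` is the cross product of `v` with `sqMap M v`. -/
def GradForm {K : Type*} [Field K] (B : MvPolynomial (Fin 3) K) (M : Fin 3 → Fin 3 → K) : Prop :=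
  ∀ v : Fin 3 → K,
    eval v (pderiv 0 B) = v 1 * sqMap M v 2 + v 2 * sqMap M v 1 ∧
    eval v (pderiv 1 B) = v 2 * sqMap M v 0 + v 0 * sqMap M v 2 ∧
    eval v (pderiv 2 B) = v 0 * sqMap M v 1 + v 1 * sqMap M v 0

lemma gradForm_monomial {K : Type*} [Field K] [CharP K 2] (d : Fin 3 →₀ ℕ) (a : K)
    (hd : d 0 + d 1 + d 2 = 4) : ∃ M, GradForm (monomial d a) M := by
  have h2 : (2 : K) = 0 := CharP.cast_eq_zero K 2
  have h3 : (3 : K) = 1 := by linear_combination h2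
  have h4 : (4 : K) = 0 := by linear_combination 2 * h2
  refine ⟨fun i j => if ∀ k, d k + (if k = i then 1 else 0) = 1 + (if k = j then 2 else 0)
    then a else 0, fun v => ?_⟩
  simp only [sqMap, pderiv_monomial, eval_monomial, Finsupp.prod_fintype, pow_zero, implies_true,
    Fin.sum_univ_three, Fin.prod_univ_three, Fin.forall_fin_succ, Finsupp.tsub_apply]
  obtain ⟨x, hx⟩ : ∃ x, d 0 = x := ⟨_, rfl⟩
  obtain ⟨y, hy⟩ : ∃ y, d 1 = y := ⟨_, rfl⟩
  obtain ⟨z, hz⟩ : ∃ z, d 2 = z := ⟨_, rfl⟩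
  have hx4 : x ≤ 4 := by omega
  have hy4 : y ≤ 4 := by omega
  rw [hx, hy, hz] at hd
  obtain rfl : z = 4 - x - y := by omega
  interval_cases x <;> interval_cases y <;> first
    | (exfalso; omega)
    | (simp [hx, hy, hz, Finsupp.single_apply, h2, h3, h4] <;> (try refine ⟨?_, ?_⟩) <;> ring)

lemma gradForm_exists {K : Type*} [Field K] [CharP K 2] (B : MvPolynomial (Fin 3) K)
    (hB : B.IsHomogeneous 4) : ∃ M, GradForm B M := by
  classical
  rw [← support_sum_monomial_coeff B]
  have hd : ∀ d ∈ B.support, d 0 + d 1 + d 2 = 4 := by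
    intro d hd
    have := hB (mem_support_iff.1 hd)
    rw [← this, Finsupp.weight_apply, Finsupp.sum_fintype _ _ (by simp)]
    simp [Fin.sum_univ_three]
  generalize B.support = s at hd
  generalize hc : (fun d => coeff d B) = c
  have hc' : ∀ d, coeff d B = c d := fun d => congrFun hc d
  simp only [hc']
  clear hc hc'
  induction s using Finset.induction_on with
  | empty => exact ⟨0, fun v => by simp [sqMap]⟩
  | insert d s hds ih =>
    rw [Finset.sum_insert hds]
    obtain ⟨M, hM⟩ := gradForm_monomial d (c d) (hd d (by simp))
    obtain ⟨N, hN⟩ := ih (fun e he => hd e (by simp [he]))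
    refine ⟨M + N, fun v => ?_⟩
    obtain ⟨a1, a2, a3⟩ := hM v
    obtain ⟨b1, b2, b3⟩ := hN v
    have hs : ∀ i, sqMap (M + N) v i = sqMap M v i + sqMap N v i := by
      intro i; simp [sqMap, add_mul, Finset.sum_add_distrib]
    simp only [map_add, a1, a2, a3, b1, b2, b3, hs]
    refine ⟨?_, ?_, ?_⟩ <;> ring

lemma sqMap_add {K : Type*} [Field K] [CharP K 2] (M : Fin 3 → Fin 3 → K) (v w : Fin 3 → K) :
    sqMap M (v + w) = sqMap M v + sqMap M w := by
  funext i
  simp [sqMap, CharTwo.add_sq, mul_add, Finset.sum_add_distrib]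

lemma sqMap_smul {K : Type*} [Field K] (M : Fin 3 → Fin 3 → K) (a : K) (v : Fin 3 → K) :
    sqMap M (a • v) = a ^ 2 • sqMap M v := by
  funext i
  simp only [sqMap, Pi.smul_apply, smul_eq_mul, Finset.mul_sum]
  exact Finset.sum_congr rfl fun j _ => by ring

lemma sqMap_comb {K : Type*} [Field K] [CharP K 2] (M : Fin 3 → Fin 3 → K)
    (T : Finset (Fin 3 → K)) (c : (Fin 3 → K) → K) (hT : ∀ e ∈ T, sqMap M e = e) :
    sqMap M (∑ e ∈ T, c e • e) = ∑ e ∈ T, c e ^ 2 • e := by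
  classical
  induction T using Finset.induction_on with
  | empty => funext i; simp [sqMap]
  | insert d s hds ih =>
    rw [Finset.sum_insert hds, Finset.sum_insert hds, sqMap_add, sqMap_smul,
      hT d (by simp), ih fun e he => hT e (by simp [he])]

lemma parallel_of_cross {K : Type*} [Field K] [CharP K 2] (v w : Fin 3 → K) (hv : v ≠ 0)
    (h0 : v 1 * w 2 + v 2 * w 1 = 0) (h1 : v 2 * w 0 + v 0 * w 2 = 0)
    (h2 : v 0 * w 1 + v 1 * w 0 = 0) : ∃ t : K, w = t • v := by
  rw [CharTwo.add_eq_zero] at h0 h1 h2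
  obtain ⟨i, hi⟩ := Function.ne_iff.1 hv
  simp only [Pi.zero_apply] at hi
  refine ⟨w i / v i, ?_⟩
  funext j
  simp only [Pi.smul_apply, smul_eq_mul]
  rw [div_mul_eq_mul_div, eq_div_iff hi]
  fin_cases i <;> fin_cases j <;> simp <;> grind

lemma mem_crit {K : Type*} [Field K] [CharP K 2] {B : MvPolynomial (Fin 3) K}
    {M : Fin 3 → Fin 3 → K} (hM : GradForm B M) (w : Fin 3 → K) (hw : w ≠ 0)
    (h : sqMap M w = 0) : Projectivization.mk K w hw ∈ critLocus B := by
  intro v hv hvw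
  obtain ⟨a, ha⟩ := (Projectivization.mk_eq_mk_iff' K v w hv hw).1 hvw
  have h0 : sqMap M v = 0 := by rw [← ha, sqMap_smul, h, smul_zero]
  obtain ⟨h1, h2, h3⟩ := hM v
  intro i
  fin_cases i <;> simp [h1, h2, h3, h0]

/-- Let `K` be algebraically closed of characteristic 2 and `B ∈ K[x₁,x₂,x₃]` homogeneous of
degree 4.  If the critical set `𝒞_B ⊆ ℙ²_K` is finite, then `|𝒞_B| ≤ 7`. -/
theorem quartic_critical_set_card_le_seven
    {K : Type*} [Field K] [IsAlgClosed K] [CharP K 2]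
    (B : MvPolynomial (Fin 3) K) (hBhom : B.IsHomogeneous 4)
    (hfin : (critLocus B).Finite) :
    (critLocus B).ncard ≤ 7 := by
  classical
  obtain ⟨M, hM⟩ := gradForm_exists B hBhom
  -- a maximal independent family of fixed vectors
  obtain ⟨b, hbF, hspan, hli⟩ := exists_linearIndependent K {v : Fin 3 → K | sqMap M v = v}
  have hbfin : b.Finite := hli.setFinite
  obtain ⟨T, rfl⟩ := hbfin.exists_finset_coe
  have hT : ∀ e ∈ T, sqMap M e = e := fun e he => hbF he
  have hli' : ∀ c : (Fin 3 → K) → K, ∑ e ∈ T, c e • e = 0 → ∀ e ∈ T, c e = 0 := by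
    intro c hc e he
    exact linearIndepOn_finset_iff.1 (show LinearIndepOn K id (T : Set (Fin 3 → K)) from hli) c hc e he
  have hcard : T.card ≤ 3 := by
    have := hli.fintype_card_le_finrank
    simpa using this
  have hmem : ∀ v, v ∈ Submodule.span K (T : Set (Fin 3 → K)) →
      ∃ c : (Fin 3 → K) → K, ∑ e ∈ T, c e • e = v := by
    intro v hv
    obtain ⟨c, -, hc⟩ := Submodule.mem_span_finset.1 hv
    exact ⟨c, hc⟩
  have hfix : ∀ v, sqMap M v = v → ∃ S ∈ T.powerset, v = ∑ e ∈ S, e := by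
    intro v hv
    obtain ⟨c, hc⟩ := hmem v (by rw [hspan]; exact Submodule.subset_span hv)
    have h1 := sqMap_comb M T c hT
    rw [hc, hv] at h1
    have h2 : ∑ e ∈ T, (c e ^ 2 - c e) • e = 0 := by
      simp only [sub_smul, Finset.sum_sub_distrib, hc, ← h1, sub_self]
    have h3 := hli' _ h2
    refine ⟨T.filter (fun e => c e = 1), by simp, ?_⟩
    rw [← hc, Finset.sum_filter]
    refine Finset.sum_congr rfl fun e he => ?_
    have h4 : c e * (c e - 1) = 0 := by linear_combination h3 e he
    rcases mul_eq_zero.1 h4 with h | h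
    · simp [h]
    · simp [sub_eq_zero.1 h]
  set P0 : Set (Projectivization K (Fin 3 → K)) := {p ∈ critLocus B | sqMap M p.rep = 0} with hP0
  have hP0fin : P0.Finite := hfin.subset fun p hp => hp.1
  let g : Finset (Fin 3 → K) → Projectivization K (Fin 3 → K) := fun S =>
    if h : ∑ e ∈ S, e ≠ 0 then Projectivization.mk K _ h else
      Projectivization.mk K (fun _ => 1) (fun h => one_ne_zero (congrFun h 0))
  have hsub : critLocus B ⊆ ((T.powerset.erase ∅).image g : Finset _) ∪ P0 := by
    intro p hp
    have hz := hp p.rep p.rep_nonzero p.mk_rep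
    obtain ⟨h1, h2, h3⟩ := hM p.rep
    rw [hz] at h1 h2 h3
    obtain ⟨t, ht⟩ := parallel_of_cross p.rep (sqMap M p.rep) p.rep_nonzero h1.symm h2.symm h3.symm
    by_cases ht0 : t = 0
    · right
      exact ⟨hp, by rw [ht, ht0, zero_smul]⟩
    · left
      have hne' : t⁻¹ ≠ 0 := inv_ne_zero ht0
      have hu0 : t⁻¹ • p.rep ≠ 0 := smul_ne_zero hne' p.rep_nonzero
      have hu : sqMap M (t⁻¹ • p.rep) = t⁻¹ • p.rep := by
        rw [sqMap_smul, ht, smul_smul]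
        congr 1
        field_simp
      obtain ⟨S, hS, hSe⟩ := hfix _ hu
      have hSne : ∑ e ∈ S, e ≠ 0 := hSe ▸ hu0
      rw [Finset.mem_coe, Finset.mem_image]
      refine ⟨S, Finset.mem_erase.2 ⟨fun h => hSne (by simp [h]), hS⟩, ?_⟩
      simp only [g, dif_pos hSne]
      conv_rhs => rw [← p.mk_rep]
      rw [Projectivization.mk_eq_mk_iff']
      exact ⟨t⁻¹, hSe⟩
  have hPle : P0.ncard ≤ 1 := by
    rw [Set.ncard_le_one hP0fin]
    intro p hp q hq
    by_contra hpq
    have hne : ∀ s : K, p.rep + s • q.rep ≠ 0 := by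
      intro s hs
      apply hpq
      rw [← p.mk_rep, ← q.mk_rep, Projectivization.mk_eq_mk_iff']
      exact ⟨-s, by rw [neg_smul]; exact (eq_neg_of_add_eq_zero_left hs).symm⟩
    have hinj : Function.Injective fun s : K => Projectivization.mk K _ (hne s) := by
      intro s r hsr
      obtain ⟨a, ha⟩ := (Projectivization.mk_eq_mk_iff' K _ _ (hne s) (hne r)).1 hsr
      have h1 : (a - 1) • p.rep = (s - a * r) • q.rep := by
        have : a • p.rep + (a * r) • q.rep = p.rep + s • q.rep := by
          rw [← ha, smul_add, smul_smul]
        rw [sub_smul, sub_smul, one_smul]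
        rw [sub_eq_sub_iff_add_eq_add, this, add_comm]
      have ha1 : a - 1 = 0 := by
        by_contra hne1
        apply hpq
        rw [← p.mk_rep, ← q.mk_rep, Projectivization.mk_eq_mk_iff']
        exact ⟨(a - 1)⁻¹ * (s - a * r), by rw [mul_smul, ← h1, inv_smul_smul₀ hne1]⟩
      rw [ha1, zero_smul] at h1
      have := (smul_eq_zero.1 h1.symm).resolve_right q.rep_nonzero
      linear_combination this + r * ha1
    haveI : Infinite K := IsAlgClosed.instInfinite
    refine Set.infinite_range_of_injective hinj (hfin.subset ?_)
    rintro _ ⟨s, rfl⟩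
    exact mem_crit hM _ _ (by rw [sqMap_add, sqMap_smul, hp.2, hq.2]; simp)
  have hP3 : T.card = 3 → P0 = ∅ := by
    intro h3
    rw [Set.eq_empty_iff_forall_notMem]
    intro p hp
    have htop : Submodule.span K (T : Set (Fin 3 → K)) = ⊤ := by
      have := hli.span_eq_top_of_card_eq_finrank' (by simp [h3])
      simpa using this
    obtain ⟨c, hc⟩ := hmem p.rep (by rw [htop]; trivial)
    have h1 := sqMap_comb M T c hT
    rw [hc, hp.2] at h1
    have h2 := hli' (fun e => c e ^ 2) h1.symm
    apply p.rep_nonzero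
    rw [← hc]
    exact Finset.sum_eq_zero fun e he => by rw [pow_eq_zero_iff two_ne_zero |>.1 (h2 e he), zero_smul]
  have h1 : (critLocus B).ncard ≤ ((T.powerset.erase ∅).image g).card + P0.ncard := by
    rw [← Set.ncard_coe_finset]
    exact (Set.ncard_le_ncard hsub ((Finset.finite_toSet _).union hP0fin)).trans
      (Set.ncard_union_le _ _)
  have h2 : ((T.powerset.erase ∅).image g).card ≤ 2 ^ T.card - 1 := by
    refine Finset.card_image_le.trans ?_
    rw [Finset.card_erase_of_mem (by simp), Finset.card_powerset]
  obtain ⟨n, hn⟩ : ∃ n, T.card = n := ⟨_, rfl⟩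
  rw [hn] at h2 hcard hP3
  interval_cases n
  · omega
  · omega
  · omega
  · rw [hP3 rfl] at h1
    simp only [Set.ncard_empty] at h1
    omega

end
end

section
/- Let K be an algebraically closed field of characteristic 2 and let X = {F = 0} ⊂ ℙ³_K be an irreducible quartic surface with Sing(X) finite. Suppose X has a double point at P = [0:0:0:1], F(x₁,x₂,x₃,z) = z²Q(x) + zG(x) + B(x), such that the projection from P is a separable double cover of ℙ², i.e. G ≢ 0. Then |Sing(X)| ≤ 25. -/
open MvPolynomial

noncomputable section

set_option linter.unusedSectionVars false

namespace SepQ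

variable {K : Type*} [Field K]

/-- rescaling variables -/
def tw {σ : Type*} : MvPolynomial σ K →+* Polynomial (MvPolynomial σ K) :=
  eval₂Hom (Polynomial.C.comp C) (fun i => Polynomial.C (X i) * Polynomial.X)

lemma tw_monomial {σ : Type*} (m : σ →₀ ℕ) (r : K) :
    tw (monomial m r) = Polynomial.C (monomial m r) * Polynomial.X ^ m.degree := by
  rw [tw, coe_eval₂Hom, eval₂_monomial, monomial_eq, Finsupp.degree_apply]
  simp only [Finsupp.prod, mul_pow, Finset.prod_mul_distrib, Finset.prod_pow_eq_pow_sum, map_mul,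
    map_prod, map_pow, RingHom.comp_apply]
  ring

lemma tw_coeff {σ : Type*} (p : MvPolynomial σ K) (k : ℕ) :
    (tw p).coeff k = homogeneousComponent k p := by
  induction p using MvPolynomial.induction_on' with
  | monomial m r =>
    rw [tw_monomial, Polynomial.coeff_C_mul_X_pow]
    split_ifs with h
    · exact (homogeneousComponent_eq_self (isHomogeneous_monomial r h.symm)).symm
    · rw [homogeneousComponent_of_mem (n := m.degree), if_neg h]
      exact isHomogeneous_monomial r rfl
  | add p q hp hq => simp [hp, hq]

lemma tw_inj {σ : Type*} {p : MvPolynomial σ K} (h : p ≠ 0) : tw p ≠ 0 := by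
  intro h0
  apply h
  rw [← sum_homogeneousComponent p]
  refine Finset.sum_eq_zero fun i _ => ?_
  rw [← tw_coeff, h0, Polynomial.coeff_zero]

lemma hom_of_tw {σ : Type*} {p : MvPolynomial σ K} 
    (h : (tw p).natDegree = (tw p).natTrailingDegree) : p.IsHomogeneous (tw p).natDegree := by
  have : p = homogeneousComponent (tw p).natDegree p := by
    nth_rw 1 [← sum_homogeneousComponent p]
    by_cases hd : (tw p).natDegree ∈ Finset.range (p.totalDegree + 1)
    · refine Finset.sum_eq_single_of_mem _ hd fun k _ hk => ?_
      rw [← tw_coeff]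
      rcases lt_or_gt_of_ne hk with h1 | h1
      · exact Polynomial.coeff_eq_zero_of_lt_natTrailingDegree (h ▸ h1)
      · exact Polynomial.coeff_eq_zero_of_natDegree_lt h1
    · rw [homogeneousComponent_eq_zero (tw p).natDegree p (by simpa using hd)]
      refine Finset.sum_eq_zero fun k hk => ?_
      rw [← tw_coeff]
      apply Polynomial.coeff_eq_zero_of_lt_natTrailingDegree
      rw [← h]
      simp at hd hk
      omega
  have h2 := homogeneousComponent_isHomogeneous (tw p).natDegree p
  rwa [← this] at h2

lemma tw_hom {σ : Type*} {p : MvPolynomial σ K} {n : ℕ} (h : p.IsHomogeneous n) :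
    tw p = Polynomial.C p * Polynomial.X ^ n := by
  ext1 k
  rw [tw_coeff, Polynomial.coeff_C_mul_X_pow, homogeneousComponent_of_mem (n := n) h]

lemma hom_factor {σ : Type*} {p q : MvPolynomial σ K} {n : ℕ} (hpq : p * q ≠ 0)
    (h : (p * q).IsHomogeneous n) : ∃ a b, p.IsHomogeneous a ∧ q.IsHomogeneous b ∧ a + b = n := by
  have hp : tw p ≠ 0 := tw_inj (left_ne_zero_of_mul hpq)
  have hq : tw q ≠ 0 := tw_inj (right_ne_zero_of_mul hpq)
  have e : tw p * tw q = Polynomial.C (p * q) * Polynomial.X ^ n := by rw [← map_mul, tw_hom h]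
  have h1 := Polynomial.natDegree_mul hp hq
  have h2 := Polynomial.natTrailingDegree_mul hp hq
  rw [e, Polynomial.natDegree_C_mul_X_pow _ _ hpq] at h1
  rw [e, Polynomial.C_mul_X_pow_eq_monomial, Polynomial.natTrailingDegree_monomial hpq] at h2
  have h3 := Polynomial.natTrailingDegree_le_natDegree (tw p)
  have h4 := Polynomial.natTrailingDegree_le_natDegree (tw q)
  exact ⟨_, _, hom_of_tw (by omega), hom_of_tw (by omega), h1.symm⟩

lemma hom_right {σ : Type*} {p q : MvPolynomial σ K} {a n : ℕ} (hp0 : p ≠ 0)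
    (hp : p.IsHomogeneous a) (h : (p * q).IsHomogeneous (a + n)) : q.IsHomogeneous n := by
  by_cases hq : q = 0
  · rw [hq]; exact isHomogeneous_zero _ _ _
  obtain ⟨a', b, h1, h2, h3⟩ := hom_factor (mul_ne_zero hp0 hq) h
  have := hp.inj_right h1 hp0
  have hb : b = n := by omega
  exact hb ▸ h2

lemma eval_smul_hom {σ : Type*} {p : MvPolynomial σ K} {n : ℕ} (h : p.IsHomogeneous n)
    (r : K) (x : σ → K) : eval (r • x) p = r ^ n * eval x p := by
  rw [eval_eq, eval_eq, Finset.mul_sum]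
  refine Finset.sum_congr rfl fun m hm => ?_
  have := h.degree_eq_sum_deg_support hm
  simp only [Pi.smul_apply, smul_eq_mul, mul_pow, Finset.prod_mul_distrib, this,
    Finset.prod_pow_eq_pow_sum]
  ring

lemma finrank_hom (n : ℕ) :
    Module.finrank K (homogeneousSubmodule (Fin 3) K n) = (n + 2).choose 2 := by
  rw [homogeneousSubmodule_eq_finsupp_supported]
  have b := basisRestrictSupport K {d : Fin 3 →₀ ℕ | d.degree = n}
  have h1 := Module.finrank_eq_nat_card_basis b
  have h2 : {d : Fin 3 →₀ ℕ | d.degree = n} = ((Finset.univ : Finset (Fin 3)).finsuppAntidiag n : Set _) := by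
    ext d
    simp [Finset.mem_finsuppAntidiag, Finsupp.degree_eq_sum]
  refine h1.trans ?_
  rw [h2]
  rw [Nat.card_coe_set_eq, Set.ncard_coe_finset, Finset.card_finsuppAntidiag_nat_eq_choose]
  simp
  rw [add_comm 2 n, Nat.choose_symm_add]

instance (n : ℕ) : FiniteDimensional K (homogeneousSubmodule (Fin 3) K n) :=
  Module.Finite.iff_fg.mpr (homogeneousSubmodule_fg _ _ n)


/-- A linear form through `p` but not through `q`. -/
lemma exists_lin {p q : Projectivization K (Fin 3 → K)} (h : p ≠ q) :
    ∃ l : MvPolynomial (Fin 3) K, l.IsHomogeneous 1 ∧ eval p.rep l = 0 ∧ eval q.rep l ≠ 0 := by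
  by_contra hcon
  push Not at hcon
  apply h
  rw [← p.mk_rep, ← q.mk_rep, Projectivization.mk_eq_mk_iff']
  obtain ⟨i, hi⟩ := Function.ne_iff.mp q.rep_nonzero
  have key : ∀ i j, p.rep i * q.rep j = p.rep j * q.rep i := by
    intro i j
    have := hcon (C (p.rep i) * X j - C (p.rep j) * X i)
      ((isHomogeneous_C_mul_X _ _).sub (isHomogeneous_C_mul_X _ _)) (by simp; ring)
    simpa [sub_eq_zero] using this
  refine ⟨p.rep i / q.rep i, ?_⟩
  ext j
  have := key i j
  simp only [Pi.zero_apply] at hi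
  simp only [Pi.smul_apply, smul_eq_mul]
  field_simp
  linear_combination this

lemma exists_lin_ne (q : Projectivization K (Fin 3 → K)) :
    ∃ l : MvPolynomial (Fin 3) K, l.IsHomogeneous 1 ∧ eval q.rep l ≠ 0 := by
  obtain ⟨i, hi⟩ := Function.ne_iff.mp q.rep_nonzero
  exact ⟨X i, isHomogeneous_X _ _, by simpa using hi⟩

/-- separating form of degree `d` for a finite set of points. -/
lemma exists_sep (T : Finset (Projectivization K (Fin 3 → K))) (q : Projectivization K (Fin 3 → K))
    (hq : q ∉ T) (d : ℕ) (hd : T.card ≤ d) :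
    ∃ f : MvPolynomial (Fin 3) K, f.IsHomogeneous d ∧ (∀ p ∈ T, eval p.rep f = 0) ∧
      eval q.rep f = 1 := by
  have h1 : ∀ p, ∃ l : MvPolynomial (Fin 3) K, l.IsHomogeneous 1 ∧ (p ∈ T → eval p.rep l = 0) ∧
      eval q.rep l ≠ 0 := by
    intro p
    by_cases hp : p ∈ T
    · obtain ⟨l, h1, h2, h3⟩ := exists_lin (p := p) (q := q) (by rintro h; exact hq (h ▸ hp))
      exact ⟨l, h1, fun _ => h2, h3⟩
    · obtain ⟨l, h1, h2⟩ := exists_lin_ne q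
      exact ⟨l, h1, fun h => (hp h).elim, h2⟩
  choose l hl1 hl2 hl3 using h1
  obtain ⟨m, hm1, hm2⟩ := exists_lin_ne q
  obtain ⟨f, hf⟩ : ∃ f, f = (∏ p ∈ T, l p) * m ^ (d - T.card) := ⟨_, rfl⟩
  have hfq : eval q.rep f ≠ 0 := by
    rw [hf, map_mul, map_prod, map_pow]
    exact mul_ne_zero (Finset.prod_ne_zero_iff.mpr fun p _ => hl3 p) (pow_ne_zero _ hm2)
  have hfh : f.IsHomogeneous d := by
    have h2 := IsHomogeneous.prod T l (fun _ => 1) (fun p _ => hl1 p)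
    have h3 := h2.mul (hm1.pow (d - T.card))
    have h4 : (∑ i ∈ T, 1) + 1 * (d - T.card) = d := by
      rw [Finset.sum_const, smul_eq_mul]; omega
    rw [h4, ← hf] at h3
    exact h3
  refine ⟨C (eval q.rep f)⁻¹ * f, hfh.C_mul _, ?_, ?_⟩
  · intro p hp
    have : eval p.rep f = 0 := by
      rw [hf, map_mul, map_prod, Finset.prod_eq_zero hp (hl2 _ hp), zero_mul]
    rw [map_mul, this, mul_zero]
  · rw [map_mul, eval_C, inv_mul_cancel₀ hfq]

lemma choose_id (a h m : ℕ) : (a + h + m + 2).choose 2 + (m + 2).choose 2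
    = (h + m + 2).choose 2 + (a + m + 2).choose 2 + a * h := by
  have e : ∀ n : ℕ, (n + 2).choose 2 * 2 = (n + 2) * (n + 1) := by
    intro n
    have := Nat.triangle_succ (n + 1)
    rw [Nat.choose_two_right, Nat.div_mul_cancel]
    · simp
    · simpa using (Nat.even_mul_pred_self (n + 2)).two_dvd
  have h1 := e (a + h + m)
  have h2 := e m
  have h3 := e (h + m)
  have h4 := e (a + m)
  nlinarith

/-- Weak Bezout for a prime form and a form not divisible by it. -/
lemma bezout {A H : MvPolynomial (Fin 3) K} {a h : ℕ} (hA : A.IsHomogeneous a)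
    (hH : H.IsHomogeneous h) (hp : Prime A) (hAH : ¬ A ∣ H)
    (T : Finset (Projectivization K (Fin 3 → K)))
    (hTA : ∀ t ∈ T, eval t.rep A = 0) (hTH : ∀ t ∈ T, eval t.rep H = 0) : T.card ≤ a * h := by
  classical
  set m := T.card with hm
  let V := fun n => homogeneousSubmodule (Fin 3) K n
  -- evaluation
  let ev : V (a + h + m) →ₗ[K] (T → K) :=
    { toFun := fun f t => eval t.1.rep f.1
      map_add' := by intros; ext; simp
      map_smul' := by intros; ext; simp [smul_eval] }
  have hev : Function.Surjective ev := by
    rw [← LinearMap.range_eq_top, eq_top_iff, ← (Pi.basisFun K T).span_eq, Submodule.span_le]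
    rintro _ ⟨t, rfl⟩
    obtain ⟨f, hf1, hf2, hf3⟩ := exists_sep (T.erase t.1) t.1 (by simp) (a + h + m)
      (by rw [Finset.card_erase_of_mem t.2]; omega)
    refine ⟨⟨f, hf1⟩, ?_⟩
    ext s
    by_cases hs : s = t
    · subst hs; simpa [ev] using hf3
    · have : eval s.1.rep f = 0 := hf2 s.1 (Finset.mem_erase.mpr ⟨fun hh => hs (Subtype.ext hh), s.2⟩)
      simp [ev, this, Pi.basisFun_apply, hs]
  let Psi : (V (h + m) × V (a + m)) →ₗ[K] V (a + h + m) :=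
    { toFun := fun uv => ⟨A * uv.1.1 + H * uv.2.1, by
        have h1 := hA.mul ((mem_homogeneousSubmodule _ _).mp uv.1.2)
        have h2 := hH.mul ((mem_homogeneousSubmodule _ _).mp uv.2.2)
        rw [show a + (h + m) = a + h + m by ring] at h1
        rw [show h + (a + m) = a + h + m by ring] at h2
        exact h1.add h2⟩
      map_add' := by intros; ext1; simp; ring
      map_smul' := by intros; ext1; simp }
  let Th : V m →ₗ[K] (V (h + m) × V (a + m)) :=
    { toFun := fun w => (⟨- (H * w.1), (hH.mul w.2).neg⟩, ⟨A * w.1, hA.mul w.2⟩)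
      map_add' := by
        intros; ext1 <;> ext1 <;> simp <;> ring
      map_smul' := by intros; ext1 <;> ext1 <;> simp }
  have hk : LinearMap.ker Psi ≤ LinearMap.range Th := by
    rintro ⟨⟨u, hu⟩, ⟨v, hv⟩⟩ huv
    have e : A * u + H * v = 0 := congrArg Subtype.val (LinearMap.mem_ker.mp huv)
    have hd : A ∣ H * v := ⟨-u, by linear_combination e⟩
    obtain ⟨w, rfl⟩ := (hp.dvd_or_dvd hd).resolve_left hAH
    have hw : w.IsHomogeneous m := hom_right hp.ne_zero hA hv
    refine ⟨⟨w, hw⟩, ?_⟩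
    have hu' : u = - (H * w) := by
      apply mul_left_cancel₀ hp.ne_zero
      linear_combination e
    subst hu'
    rfl
  have hr : LinearMap.range Psi ≤ LinearMap.ker ev := by
    rintro _ ⟨⟨⟨u, hu⟩, ⟨v, hv⟩⟩, rfl⟩
    rw [LinearMap.mem_ker]
    ext t
    simp [ev, Psi, hTA t.1 t.2, hTH t.1 t.2]
  have d1 := LinearMap.finrank_range_add_finrank_ker ev
  have d2 := LinearMap.finrank_range_add_finrank_ker Psi
  have d3 := (Submodule.finrank_mono hk).trans (LinearMap.finrank_range_le Th)
  have d4 := Submodule.finrank_mono hr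
  rw [LinearMap.range_eq_top.mpr hev, finrank_top, Module.finrank_fintype_fun_eq_card,
    Fintype.card_coe] at d1
  rw [Module.finrank_prod] at d2
  have hV : ∀ n, Module.finrank K (V n) = (n + 2).choose 2 := finrank_hom
  rw [hV] at d1 d3
  rw [hV, hV] at d2
  have := choose_id a h m
  omega

lemma sc_s {K : Type*} [Field K] [CharP K 2] (x1 x2 x3 d0 d1 d2 d3 g0 g1 g2 g3 w : K)
  (hG : x1*g1^2+x2*g2^2+x3*g3^2+x1*x2*x3*g0^2 = 0)
  (hx : x1 ≠ 0 ∨ x2 ≠ 0 ∨ x3 ≠ 0)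
  (h1 : x3*d2^2+x2*d3^2 = w * (g1^2+x2*x3*g0^2))
  (h2 : x3*d1^2+x1*d3^2 = w * (g2^2+x1*x3*g0^2))
  (h3 : x2*d1^2+x1*d2^2 = w * (g3^2+x1*x2*g0^2)) :
  (d1*g1+d2*g2+d3*g3+g0*d0)^2 = g0^2 * (d0^2+x2*x3*d1^2+x1*x3*d2^2+x1*x2*d3^2) := by
  have t : (2:K) = 0 := CharTwo.two_eq_zero
  have e1 : x1 * (d1^2*(g1^2+x2*x3*g0^2)+d2^2*(g2^2+x1*x3*g0^2)+d3^2*(g3^2+x1*x2*g0^2)) = 0 := by grind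
  have e2 : x2 * (d1^2*(g1^2+x2*x3*g0^2)+d2^2*(g2^2+x1*x3*g0^2)+d3^2*(g3^2+x1*x2*g0^2)) = 0 := by grind
  have e3 : x3 * (d1^2*(g1^2+x2*x3*g0^2)+d2^2*(g2^2+x1*x3*g0^2)+d3^2*(g3^2+x1*x2*g0^2)) = 0 := by grind
  have e : (d1^2*(g1^2+x2*x3*g0^2)+d2^2*(g2^2+x1*x3*g0^2)+d3^2*(g3^2+x1*x2*g0^2)) = 0 := by
    rcases hx with h | h | h
    · exact (mul_eq_zero.mp e1).resolve_left h
    · exact (mul_eq_zero.mp e2).resolve_left h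
    · exact (mul_eq_zero.mp e3).resolve_left h
  grind

lemma sc_r {K : Type*} [Field K] [CharP K 2] (x1 x2 x3 d0 d1 d2 d3 g1 g2 g3 : K)
  (hG : x1*g1^2+x2*g2^2+x3*g3^2 = 0)
  (ht : d1*g1+d2*g2+d3*g3 = 0) :
  (d0*g3+d1*x2*g2+d2*x1*g1)^2 = g3^2 * (d0^2+x2*x3*d1^2+x1*x3*d2^2+x1*x2*d3^2) := by
  have t : (2:K) = 0 := CharTwo.two_eq_zero
  have e : d3^2*g3^2 = d1^2*g1^2+d2^2*g2^2 := by grind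
  grind
lemma sq_inj {K : Type*} [Field K] [CharP K 2] {a b : K} (h : a^2 = b^2) : a = b := by
  have t : (2:K) = 0 := CharTwo.two_eq_zero
  have : (a-b)^2 = 0 := by grind
  exact sub_eq_zero.mp (pow_eq_zero_iff (two_ne_zero) |>.mp this)

lemma pd_even {K : Type*} [Field K] [CharP K 2] (d0 d1 d2 d3 : MvPolynomial (Fin 3) K) :
    pderiv 0 (d0^2 + X 1 * X 2 * d1^2 + X 0 * X 2 * d2^2 + X 0 * X 1 * d3^2) =
      X 2 * d2^2 + X 1 * d3^2 ∧
    pderiv 1 (d0^2 + X 1 * X 2 * d1^2 + X 0 * X 2 * d2^2 + X 0 * X 1 * d3^2) =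
      X 2 * d1^2 + X 0 * d3^2 ∧
    pderiv 2 (d0^2 + X 1 * X 2 * d1^2 + X 0 * X 2 * d2^2 + X 0 * X 1 * d3^2) =
      X 1 * d1^2 + X 0 * d2^2 := by
  have t : (2:MvPolynomial (Fin 3) K) = 0 := CharTwo.two_eq_zero
  refine ⟨?_, ?_, ?_⟩ <;>
  · simp [Derivation.leibniz, Derivation.leibniz_pow, pderiv_X, t]
    try ring

lemma pd_odd {K : Type*} [Field K] [CharP K 2] (d0 d1 d2 d3 : MvPolynomial (Fin 3) K) :
    pderiv 0 (X 0 * d1^2 + X 1 * d2^2 + X 2 * d3^2 + X 0 * X 1 * X 2 * d0^2) =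
      d1^2 + X 1 * X 2 * d0^2 ∧
    pderiv 1 (X 0 * d1^2 + X 1 * d2^2 + X 2 * d3^2 + X 0 * X 1 * X 2 * d0^2) =
      d2^2 + X 0 * X 2 * d0^2 ∧
    pderiv 2 (X 0 * d1^2 + X 1 * d2^2 + X 2 * d3^2 + X 0 * X 1 * X 2 * d0^2) =
      d3^2 + X 0 * X 1 * d0^2 := by
  have t : (2:MvPolynomial (Fin 3) K) = 0 := CharTwo.two_eq_zero
  refine ⟨?_, ?_, ?_⟩ <;>
  · simp [Derivation.leibniz, Derivation.leibniz_pow, pderiv_X, t]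
    try ring

lemma hmon {K : Type*} [Field K] (r : K) (a b c n : ℕ) (h : a + b + c = n) :
    (C r * (X 0 ^ a * X 1 ^ b * X 2 ^ c) : MvPolynomial (Fin 3) K).IsHomogeneous n :=
  h ▸ (((isHomogeneous_X_pow _ _).mul (isHomogeneous_X_pow _ _)).mul (isHomogeneous_X_pow _ _)).C_mul _

lemma mon_eq {K : Type*} [Field K] (r : K) (m : Fin 3 →₀ ℕ) :
    monomial m r = C r * (X 0 ^ m 0 * X 1 ^ m 1 * X 2 ^ m 2) := by
  rw [monomial_eq, Finsupp.prod_fintype _ _ (by simp), Fin.prod_univ_three]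

lemma hom_ind {K : Type*} [Field K] {n : ℕ} (P : MvPolynomial (Fin 3) K → Prop)
    (h0 : P 0) (hadd : ∀ p q, P p → P q → P (p + q))
    (hm : ∀ (r : K) (a b c : ℕ), a + b + c = n → P (C r * (X 0 ^ a * X 1 ^ b * X 2 ^ c)))
    (D : MvPolynomial (Fin 3) K) (hD : D.IsHomogeneous n) : P D := by
  rw [D.as_sum]
  refine Finset.sum_induction _ P hadd h0 fun m hm' => ?_
  rw [mon_eq]
  apply hm
  have := hD.degree_eq_sum_deg_support hm'
  rw [this, ← Finsupp.degree_apply, Finsupp.degree_eq_sum, Fin.sum_univ_three]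

lemma dec_even {K : Type*} [Field K] [IsAlgClosed K] [CharP K 2] (D : MvPolynomial (Fin 3) K)
    (hD : D.IsHomogeneous 6) : ∃ d0 d1 d2 d3 : MvPolynomial (Fin 3) K,
    d0.IsHomogeneous 3 ∧ d1.IsHomogeneous 2 ∧ d2.IsHomogeneous 2 ∧ d3.IsHomogeneous 2 ∧
    D = d0^2 + X 1 * X 2 * d1^2 + X 0 * X 2 * d2^2 + X 0 * X 1 * d3^2 := by
  have t : (2:MvPolynomial (Fin 3) K) = 0 := CharTwo.two_eq_zero
  have z : ∀ n, (0 : MvPolynomial (Fin 3) K).IsHomogeneous n := isHomogeneous_zero _ _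
  refine hom_ind (fun D => ∃ d0 d1 d2 d3 : MvPolynomial (Fin 3) K,
    d0.IsHomogeneous 3 ∧ d1.IsHomogeneous 2 ∧ d2.IsHomogeneous 2 ∧ d3.IsHomogeneous 2 ∧
    D = d0^2 + X 1 * X 2 * d1^2 + X 0 * X 2 * d2^2 + X 0 * X 1 * d3^2) ?_ ?_ ?_ D hD
  · exact ⟨0, 0, 0, 0, z _, z _, z _, z _, by ring⟩
  · rintro p q ⟨a0, a1, a2, a3, h0, h1, h2, h3, rfl⟩ ⟨b0, b1, b2, b3, k0, k1, k2, k3, rfl⟩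
    refine ⟨_, _, _, _, h0.add k0, h1.add k1, h2.add k2, h3.add k3, ?_⟩
    simp only [CharTwo.add_sq]
    ring
  · intro r a b c habc
    obtain ⟨s, rfl⟩ := IsAlgClosed.exists_pow_nat_eq r (n := 2) (by norm_num)
    rcases Nat.even_or_odd' a with ⟨a, rfl | rfl⟩ <;> rcases Nat.even_or_odd' b with ⟨b, rfl | rfl⟩ <;>
      rcases Nat.even_or_odd' c with ⟨c, rfl | rfl⟩ <;> try omega
    · refine ⟨_, 0, 0, 0, hmon s a b c 3 (by omega), z _, z _, z _, ?_⟩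
      rw [map_pow]; ring
    · refine ⟨0, _, 0, 0, z _, hmon s a b c 2 (by omega), z _, z _, ?_⟩
      rw [map_pow]; ring
    · refine ⟨0, 0, _, 0, z _, z _, hmon s a b c 2 (by omega), z _, ?_⟩
      rw [map_pow]; ring
    · refine ⟨0, 0, 0, _, z _, z _, z _, hmon s a b c 2 (by omega), ?_⟩
      rw [map_pow]; ring

lemma dec_odd {K : Type*} [Field K] [IsAlgClosed K] [CharP K 2] (D : MvPolynomial (Fin 3) K)
    (hD : D.IsHomogeneous 3) : ∃ d0 d1 d2 d3 : MvPolynomial (Fin 3) K,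
    d0.IsHomogeneous 0 ∧ d1.IsHomogeneous 1 ∧ d2.IsHomogeneous 1 ∧ d3.IsHomogeneous 1 ∧
    D = X 0 * d1^2 + X 1 * d2^2 + X 2 * d3^2 + X 0 * X 1 * X 2 * d0^2 := by
  have t : (2:MvPolynomial (Fin 3) K) = 0 := CharTwo.two_eq_zero
  have z : ∀ n, (0 : MvPolynomial (Fin 3) K).IsHomogeneous n := isHomogeneous_zero _ _
  refine hom_ind (fun D => ∃ d0 d1 d2 d3 : MvPolynomial (Fin 3) K,
    d0.IsHomogeneous 0 ∧ d1.IsHomogeneous 1 ∧ d2.IsHomogeneous 1 ∧ d3.IsHomogeneous 1 ∧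
    D = X 0 * d1^2 + X 1 * d2^2 + X 2 * d3^2 + X 0 * X 1 * X 2 * d0^2) ?_ ?_ ?_ D hD
  · exact ⟨0, 0, 0, 0, z _, z _, z _, z _, by ring⟩
  · rintro p q ⟨a0, a1, a2, a3, h0, h1, h2, h3, rfl⟩ ⟨b0, b1, b2, b3, k0, k1, k2, k3, rfl⟩
    refine ⟨_, _, _, _, h0.add k0, h1.add k1, h2.add k2, h3.add k3, ?_⟩
    simp only [CharTwo.add_sq]
    ring
  · intro r a b c habc
    obtain ⟨s, rfl⟩ := IsAlgClosed.exists_pow_nat_eq r (n := 2) (by norm_num)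
    rcases Nat.even_or_odd' a with ⟨a, rfl | rfl⟩ <;> rcases Nat.even_or_odd' b with ⟨b, rfl | rfl⟩ <;>
      rcases Nat.even_or_odd' c with ⟨c, rfl | rfl⟩ <;> try omega
    · refine ⟨0, 0, 0, _, z _, z _, z _, hmon s a b c 1 (by omega), ?_⟩
      rw [map_pow]; ring
    · refine ⟨0, 0, _, 0, z _, z _, hmon s a b c 1 (by omega), z _, ?_⟩
      rw [map_pow]; ring
    · refine ⟨0, _, 0, 0, z _, hmon s a b c 1 (by omega), z _, z _, ?_⟩
      rw [map_pow]; ring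
    · refine ⟨_, 0, 0, 0, hmon s a b c 0 (by omega), z _, z _, z _, ?_⟩
      rw [map_pow]; ring

/-- The key system of equations, of degree at most six. -/
lemma system {K : Type*} [Field K] [IsAlgClosed K] [CharP K 2] (D G : MvPolynomial (Fin 3) K)
    (hD : D.IsHomogeneous 6) (hG : G.IsHomogeneous 3) :
    ∃ H : Fin 4 → MvPolynomial (Fin 3) K, (∀ j, ∃ e ≤ 6, (H j).IsHomogeneous e) ∧
      ∀ x : Fin 3 → K, x ≠ 0 → eval x G = 0 →
      ((∃ w, eval x D = w ^ 2 ∧ ∀ i, eval x (pderiv i D) = w * eval x (pderiv i G)) ↔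
        ∀ j, eval x (H j) = 0) := by
  have t : (2:K) = 0 := CharTwo.two_eq_zero
  have hD' : ∀ i, (pderiv i D).IsHomogeneous 5 := fun i => hD.pderiv
  have hG' : ∀ i, (pderiv i G).IsHomogeneous 2 := fun i => hG.pderiv
  obtain ⟨d0, d1, d2, d3, hd0, hd1, hd2, hd3, eD⟩ := dec_even D hD
  obtain ⟨g0, g1, g2, g3, hg0, hg1, hg2, hg3, eG⟩ := dec_odd G hG
  obtain ⟨pD0, pD1, pD2⟩ := pd_even d0 d1 d2 d3
  obtain ⟨pG0, pG1, pG2⟩ := pd_odd g0 g1 g2 g3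
  rw [← eD] at pD0 pD1 pD2
  rw [← eG] at pG0 pG1 pG2
  obtain ⟨c, rfl⟩ : ∃ c, g0 = C c := ⟨_, totalDegree_eq_zero_iff_eq_C.mp
    ((totalDegree_zero_iff_isHomogeneous _).mpr hg0)⟩
  have hx' : ∀ x : Fin 3 → K, x ≠ 0 → x 0 ≠ 0 ∨ x 1 ≠ 0 ∨ x 2 ≠ 0 := by
    intro x hx
    by_contra! hcon
    apply hx
    ext i
    fin_cases i <;> simp [hcon]
  by_cases hc : c = 0
  · subst hc
    refine ⟨![d1 * g1 + d2 * g2 + d3 * g3,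
      pderiv 0 D - g1 * (d0 * g1 + d2 * X 2 * g3 + d3 * X 1 * g2),
      pderiv 1 D - g2 * (d0 * g2 + d1 * X 2 * g3 + d3 * X 0 * g1),
      pderiv 2 D - g3 * (d0 * g3 + d1 * X 1 * g2 + d2 * X 0 * g1)], ?_, ?_⟩
    · have hr : ∀ (p1 p2 p3 q1 q2 q3 : MvPolynomial (Fin 3) K) (i j : Fin 3), p1.IsHomogeneous 3 →
          q1.IsHomogeneous 1 → p2.IsHomogeneous 2 → q2.IsHomogeneous 1 → p3.IsHomogeneous 2 →
          q3.IsHomogeneous 1 →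
          (q1 * (p1 * q1 + p2 * X i * q2 + p3 * X j * q3)).IsHomogeneous 5 := by
        intro p1 p2 p3 q1 q2 q3 i j h1 k1 h2 k2 h3 k3
        exact k1.mul (((h1.mul k1).add ((h2.mul (isHomogeneous_X _ _)).mul k2)).add
          ((h3.mul (isHomogeneous_X _ _)).mul k3))
      intro j
      fin_cases j
      · exact ⟨3, by norm_num, ((hd1.mul hg1).add (hd2.mul hg2)).add (hd3.mul hg3)⟩
      · exact ⟨5, by norm_num, (hD' 0).sub (hr _ _ _ _ _ _ _ _ hd0 hg1 hd2 hg3 hd3 hg2)⟩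
      · exact ⟨5, by norm_num, (hD' 1).sub (hr _ _ _ _ _ _ _ _ hd0 hg2 hd1 hg3 hd3 hg1)⟩
      · exact ⟨5, by norm_num, (hD' 2).sub (hr _ _ _ _ _ _ _ _ hd0 hg3 hd1 hg2 hd2 hg1)⟩
    · intro x hx hGx
      simp only [Fin.forall_fin_succ, Fin.forall_fin_zero, Matrix.cons_val_zero, Matrix.cons_val_succ]
      have e0 : (Fin.succ 0 : Fin 3) = 1 := rfl
      have e1 : (Fin.succ (Fin.succ 0) : Fin 3) = 2 := rfl
      have sr1 := sc_r (x 2) (x 1) (x 0) (eval x d0) (eval x d3) (eval x d2) (eval x d1) (eval x g3) (eval x g2) (eval x g1)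
      have sr2 := sc_r (x 0) (x 2) (x 1) (eval x d0) (eval x d1) (eval x d3) (eval x d2) (eval x g1) (eval x g3) (eval x g2)
      have sr3 := sc_r (x 0) (x 1) (x 2) (eval x d0) (eval x d1) (eval x d2) (eval x d3) (eval x g1) (eval x g2) (eval x g3)
      have ss := sc_s (x 0) (x 1) (x 2) (eval x d0) (eval x d1) (eval x d2) (eval x d3) 0 (eval x g1) (eval x g2) (eval x g3)
      have hx2 := hx' x hx
      rw [e0, e1, pD0, pD1, pD2, pG0, pG1, pG2, eD]
      rw [eG] at hGx
      simp only [map_add, map_sub, map_mul, map_pow, eval_X, eval_C] at hGx ⊢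
      generalize eval x d0 = d0 at *
      generalize eval x d1 = d1 at *
      generalize eval x d2 = d2 at *
      generalize eval x d3 = d3 at *
      generalize eval x g1 = g1 at *
      generalize eval x g2 = g2 at *
      generalize eval x g3 = g3 at *
      constructor
      · rintro ⟨w, h1, h2, h3, h4, -⟩
        have hs := ss w (by linear_combination hGx) hx2 h2 h3 h4
        have ht : d1 * g1 + d2 * g2 + d3 * g3 = 0 := by
          have : (d1 * g1 + d2 * g2 + d3 * g3) ^ 2 = 0 := by linear_combination hs
          exact pow_eq_zero_iff two_ne_zero |>.mp this
        have r1 := sr1 (by linear_combination hGx) (by linear_combination ht)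
        have r2 := sr2 (by linear_combination hGx) (by linear_combination ht)
        have r3 := sr3 (by linear_combination hGx) (by linear_combination ht)
        have w1 := sq_inj (b := g1 * w) (r1.trans (by linear_combination g1 ^ 2 * h1))
        have w2 := sq_inj (b := g2 * w) (r2.trans (by linear_combination g2 ^ 2 * h1))
        have w3 := sq_inj (b := g3 * w) (r3.trans (by linear_combination g3 ^ 2 * h1))
        refine ⟨ht, ?_, ?_, ?_, ?_⟩
        · linear_combination h2 - g1 * w1
        · linear_combination h3 - g2 * w2
        · linear_combination h4 - g3 * w3
        · trivial
      · rintro ⟨ht, h2, h3, h4, -⟩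
        have r1 := sr1 (by linear_combination hGx) (by linear_combination ht)
        have r2 := sr2 (by linear_combination hGx) (by linear_combination ht)
        have r3 := sr3 (by linear_combination hGx) (by linear_combination ht)
        obtain ⟨w, hw⟩ := IsAlgClosed.exists_pow_nat_eq
          (d0^2 + x 1 * x 2 * d1^2 + x 0 * x 2 * d2^2 + x 0 * x 1 * d3^2) (n := 2) (by norm_num)
        have w1 := sq_inj (b := g1 * w) (r1.trans (by linear_combination -g1 ^ 2 * hw))
        have w2 := sq_inj (b := g2 * w) (r2.trans (by linear_combination -g2 ^ 2 * hw))
        have w3 := sq_inj (b := g3 * w) (r3.trans (by linear_combination -g3 ^ 2 * hw))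
        refine ⟨w, hw.symm, ?_, ?_, ?_, ?_⟩
        · linear_combination h2 + g1 * w1
        · linear_combination h3 + g2 * w2
        · linear_combination h4 + g3 * w3
        · trivial
  · obtain ⟨T, hT⟩ : ∃ T, T = d1 * g1 + d2 * g2 + d3 * g3 + C c * d0 := ⟨_, rfl⟩
    have hTh : T.IsHomogeneous 3 := by
      rw [hT]
      exact (((hd1.mul hg1).add (hd2.mul hg2)).add (hd3.mul hg3)).add (hd0.C_mul _)
    refine ⟨![T ^ 2 - C (c ^ 2) * D, C c * pderiv 0 D - T * pderiv 0 G,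
      C c * pderiv 1 D - T * pderiv 1 G, C c * pderiv 2 D - T * pderiv 2 G], ?_, ?_⟩
    · intro j
      fin_cases j
      · exact ⟨6, by norm_num, (hTh.pow 2).sub (hD.C_mul _)⟩
      · exact ⟨5, by norm_num, ((hD' 0).C_mul _).sub (hTh.mul (hG' 0))⟩
      · exact ⟨5, by norm_num, ((hD' 1).C_mul _).sub (hTh.mul (hG' 1))⟩
      · exact ⟨5, by norm_num, ((hD' 2).C_mul _).sub (hTh.mul (hG' 2))⟩
    · intro x hx hGx
      simp only [Fin.forall_fin_succ, Fin.forall_fin_zero, Matrix.cons_val_zero, Matrix.cons_val_succ]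
      have e0 : (Fin.succ 0 : Fin 3) = 1 := rfl
      have e1 : (Fin.succ (Fin.succ 0) : Fin 3) = 2 := rfl
      have ss := sc_s (x 0) (x 1) (x 2) (eval x d0) (eval x d1) (eval x d2) (eval x d3) c (eval x g1) (eval x g2) (eval x g3)
      have hx2 := hx' x hx
      rw [e0, e1]
      simp only [map_sub, map_mul, map_pow, eval_C]
      constructor
      · rintro ⟨w, h1, h2, h3, h4, -⟩
        have hs : eval x T ^ 2 = c ^ 2 * eval x D := by
          rw [hT, eD]
          rw [pD0, pG0] at h2
          rw [pD1, pG1] at h3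
          rw [pD2, pG2] at h4
          rw [eG] at hGx
          simp only [map_add, map_mul, map_pow, eval_X, eval_C] at hGx h2 h3 h4 ⊢
          exact ss w hGx hx2 h2 h3 h4
        have hw : eval x T = c * w := sq_inj (by rw [hs, h1]; ring)
        refine ⟨?_, ?_, ?_, ?_, ?_⟩
        · linear_combination hs
        · rw [h2, hw]; ring
        · rw [h3, hw]; ring
        · rw [h4, hw]; ring
        · trivial
      · rintro ⟨h1, h2, h3, h4, -⟩
        refine ⟨eval x T / c, ?_, ?_, ?_, ?_, ?_⟩
        · field_simp; linear_combination -h1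
        · field_simp; linear_combination h2
        · field_simp; linear_combination h3
        · field_simp; linear_combination h4
        · trivial

/-- The conditions for `(x, z)` to be a singular point of `z²Q + zG + B = 0`. -/
def SingAt {K : Type*} [Field K] (Q G B : MvPolynomial (Fin 3) K) (x : Fin 3 → K) (z : K) : Prop :=
  z ^ 2 * eval x Q + z * eval x G + eval x B = 0 ∧ eval x G = 0 ∧
    ∀ i, z ^ 2 * eval x (pderiv i Q) + z * eval x (pderiv i G) + eval x (pderiv i B) = 0

section plane

variable {K : Type*} [Field K] [IsAlgClosed K] [CharP K 2] {Q G B : MvPolynomial (Fin 3) K}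

lemma sing_w {x : Fin 3 → K} {z : K} (h : SingAt Q G B x z) :
    ∃ w, eval x (Q * B) = w ^ 2 ∧ ∀ i, eval x (pderiv i (Q * B)) = w * eval x (pderiv i G) := by
  have t : (2:K) = 0 := CharTwo.two_eq_zero
  obtain ⟨h1, h2, h3⟩ := h
  refine ⟨z * eval x Q, ?_, fun i => ?_⟩
  · rw [map_mul]
    linear_combination eval x Q * h1 - z * eval x Q * h2 - z ^ 2 * eval x Q ^ 2 * t
  · have h4 := h3 i
    simp only [Derivation.leibniz, smul_eq_mul, map_add, map_mul]
    linear_combination eval x Q * h4 + eval x (pderiv i Q) * (h1 - z * h2) -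
      (z * eval x Q * eval x (pderiv i G) + z ^ 2 * eval x Q * eval x (pderiv i Q)) * t

lemma w_sing {x : Fin 3 → K} (hQ : eval x Q ≠ 0) (hG : eval x G = 0)
    (h : ∃ w, eval x (Q * B) = w ^ 2 ∧
      ∀ i, eval x (pderiv i (Q * B)) = w * eval x (pderiv i G)) : ∃ z, SingAt Q G B x z := by
  have t : (2:K) = 0 := CharTwo.two_eq_zero
  obtain ⟨w, h1, h2⟩ := h
  refine ⟨w / eval x Q, ?_, hG, fun i => ?_⟩
  · rw [map_mul] at h1
    rw [hG]
    field_simp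
    linear_combination -h1 + eval x Q * eval x B * t
  · have h3 := h2 i
    rw [map_mul] at h1
    simp only [Derivation.leibniz, smul_eq_mul, map_add, map_mul] at h3
    have : eval x Q * ((w / eval x Q) ^ 2 * eval x (pderiv i Q)
        + w / eval x Q * eval x (pderiv i G) + eval x (pderiv i B)) = 0 := by
      field_simp
      linear_combination - eval x (pderiv i Q) * h1 - eval x Q * h3 +
        (eval x Q * eval x B * eval x (pderiv i Q) + eval x Q ^ 2 * eval x (pderiv i B)) * t
    exact (mul_eq_zero.mp this).resolve_left hQ

lemma fiber_one {x : Fin 3 → K} (hQ : eval x Q ≠ 0) {z z' : K} (h : SingAt Q G B x z)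
    (h' : SingAt Q G B x z') : z = z' := by
  apply sq_inj
  apply mul_right_cancel₀ hQ
  obtain ⟨h1, h2, -⟩ := h
  obtain ⟨h1', -, -⟩ := h'
  linear_combination h1 - h1' - (z - z') * h2

lemma fiber_two {x : Fin 3 → K} (S : Finset K) (hS : ∀ z, z ∈ S ↔ SingAt Q G B x z) :
    S.card ≤ 2 := by
  classical
  by_cases hQ : eval x Q = 0
  swap
  · have : S.card ≤ 1 := Finset.card_le_one.mpr fun a ha b hb =>
      fiber_one hQ ((hS a).mp ha) ((hS b).mp hb)
    omega
  by_cases hall : ∀ i, eval x (pderiv i Q) = 0 ∧ eval x (pderiv i G) = 0 ∧ eval x (pderiv i B) = 0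
  · rcases S.eq_empty_or_nonempty with rfl | ⟨z, hz⟩
    · simp
    · exfalso
      obtain ⟨h1, h2, h3⟩ := (hS z).mp hz
      rw [hQ, h2] at h1
      obtain ⟨z', hz'⟩ := Infinite.exists_notMem_finset S
      apply hz'
      rw [hS]
      refine ⟨?_, h2, fun i => ?_⟩
      · rw [hQ, h2]; linear_combination h1
      · obtain ⟨e1, e2, e3⟩ := hall i
        rw [e1, e2, e3]; ring
  · push Not at hall
    obtain ⟨i, hi⟩ := hall
    set p : Polynomial K := Polynomial.C (eval x (pderiv i Q)) * Polynomial.X ^ 2 +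
      Polynomial.C (eval x (pderiv i G)) * Polynomial.X + Polynomial.C (eval x (pderiv i B)) with hp
    have hp0 : p ≠ 0 := by
      intro h0
      have c0 := congrArg (fun q => Polynomial.coeff q 0) h0
      have c1 := congrArg (fun q => Polynomial.coeff q 1) h0
      have c2 := congrArg (fun q => Polynomial.coeff q 2) h0
      simp [hp, Polynomial.coeff_X, Polynomial.coeff_C] at c0 c1 c2
      exact hi c2 c1 c0
    have hsub : S ⊆ p.roots.toFinset := by
      intro z hz
      rw [Multiset.mem_toFinset, Polynomial.mem_roots hp0]
      have := ((hS z).mp hz).2.2 i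
      simp only [hp, Polynomial.IsRoot, Polynomial.eval_add, Polynomial.eval_mul,
        Polynomial.eval_C, Polynomial.eval_pow, Polynomial.eval_X]
      linear_combination this
    calc S.card ≤ _ := Finset.card_le_card hsub
      _ ≤ _ := Multiset.toFinset_card_le _
      _ ≤ _ := Polynomial.card_roots' _
      _ ≤ 2 := Polynomial.natDegree_quadratic_le

lemma exists_lin_ndvd {c : MvPolynomial (Fin 3) K} {n : ℕ} (hc : Prime c) (hch : c.IsHomogeneous n)
    (p : Projectivization K (Fin 3 → K)) :
    ∃ l : MvPolynomial (Fin 3) K, l.IsHomogeneous 1 ∧ eval p.rep l = 0 ∧ ¬ c ∣ l := by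
  by_contra! hcon
  obtain ⟨i, hi⟩ := Function.ne_iff.mp p.rep_nonzero
  simp only [Pi.zero_apply] at hi
  obtain ⟨j, k, hj, hk, hjk⟩ : ∃ j k : Fin 3, j ≠ i ∧ k ≠ i ∧ j ≠ k := by
    have : ∀ i : Fin 3, ∃ j k : Fin 3, j ≠ i ∧ k ≠ i ∧ j ≠ k := by decide
    exact this i
  have hl : ∀ j, c ∣ (C (p.rep i) * X j - C (p.rep j) * X i) := fun j =>
    hcon _ ((isHomogeneous_C_mul_X _ _).sub (isHomogeneous_C_mul_X _ _)) (by simp; ring)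
  have hlh : (C (p.rep i) * X j - C (p.rep j) * X i : MvPolynomial (Fin 3) K).IsHomogeneous 1 :=
    (isHomogeneous_C_mul_X _ _).sub (isHomogeneous_C_mul_X _ _)
  have hev : ∀ a b : Fin 3, b ≠ i → eval (Pi.single b (1:K))
      (C (p.rep i) * X a - C (p.rep a) * X i) = if a = b then p.rep i else 0 := by
    intro a b hb
    simp [Pi.single_apply, hb.symm]
  have hl0 : (C (p.rep i) * X j - C (p.rep j) * X i : MvPolynomial (Fin 3) K) ≠ 0 := by
    intro h0
    have := hev j j hj
    rw [h0] at this
    simp at this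
    exact hi this.symm
  obtain ⟨q, hq⟩ := hl j
  rw [hq] at hl0 hlh
  obtain ⟨a, b, ha, hb, hab⟩ := hom_factor hl0 hlh
  have ha0 : a ≠ 0 := by
    rintro rfl
    apply hc.not_isUnit
    rw [totalDegree_eq_zero_iff_eq_C.mp ((totalDegree_zero_iff_isHomogeneous _).mpr ha)]
    apply IsUnit.map
    rw [isUnit_iff_ne_zero]
    intro h0
    apply hc.ne_zero
    rw [totalDegree_eq_zero_iff_eq_C.mp ((totalDegree_zero_iff_isHomogeneous _).mpr ha), h0, C_0]
  obtain rfl : b = 0 := by omega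
  have hqC := totalDegree_eq_zero_iff_eq_C.mp ((totalDegree_zero_iff_isHomogeneous _).mpr hb)
  have e1 := hev j k hk
  rw [hq, if_neg hjk, map_mul, hqC, eval_C] at e1
  have hq0 : coeff 0 q ≠ 0 := by
    intro h0
    apply hl0
    rw [hqC, h0, C_0, mul_zero]
  have e2 := (mul_eq_zero.mp e1).resolve_right hq0
  obtain ⟨r, hr⟩ := hl k
  have e3 := hev k k hk
  rw [hr, map_mul, e2, zero_mul, if_pos rfl] at e3
  exact hi e3.symm

lemma nullst {c f : MvPolynomial (Fin 3) K} (hc : Prime c)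
    (h : ∀ x : Fin 3 → K, eval x c = 0 → eval x f = 0) : c ∣ f := by
  have hP : (Ideal.span {c}).IsPrime := (Ideal.span_singleton_prime hc.ne_zero).mpr hc
  rw [← Ideal.mem_span_singleton, ← IsPrime.vanishingIdeal_zeroLocus (K := K) (Ideal.span {c}),
    mem_vanishingIdeal_iff]
  intro x hx
  rw [mem_zeroLocus_iff] at hx
  have := hx c (Ideal.mem_span_singleton_self c)
  exact h x this

/-- `eval` at the representative of `mk x`. -/
lemma rep_eval {f : MvPolynomial (Fin 3) K} {n : ℕ} (hf : f.IsHomogeneous n) {x : Fin 3 → K}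
    (hx : x ≠ 0) : eval (Projectivization.mk K x hx).rep f = 0 ↔ eval x f = 0 := by
  obtain ⟨a, ha⟩ := Projectivization.exists_smul_eq_mk_rep K x hx
  rw [← ha, Units.smul_def, eval_smul_hom hf]
  simp

lemma infinite_pts {c : MvPolynomial (Fin 3) K} {n : ℕ} (hc : Prime c) (hch : c.IsHomogeneous n)
    (hQ : Q.IsHomogeneous 2) (hcQ : ¬ c ∣ Q) (T : Finset (Projectivization K (Fin 3 → K))) :
    ∃ t ∉ T, eval t.rep c = 0 ∧ eval t.rep Q ≠ 0 := by
  by_contra! hcon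
  have h1 := exists_lin_ndvd hc hch
  choose l hl1 hl2 hl3 using h1
  have : c ∣ Q * ∏ p ∈ T, l p := by
    apply nullst hc
    intro x hx
    rw [map_mul, map_prod, mul_eq_zero]
    by_cases hx0 : x = 0
    · left
      have := eval_smul_hom hQ 0 x
      rw [hx0] at this ⊢
      simpa using this
    · by_cases hT : Projectivization.mk K x hx0 ∈ T
      · right
        exact Finset.prod_eq_zero hT ((rep_eval (hl1 _) hx0).mp (hl2 _))
      · left
        exact (rep_eval hQ hx0).mp (hcon _ hT ((rep_eval hch hx0).mpr hx))
  rcases hc.dvd_or_dvd this with h | h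
  · exact hcQ h
  · obtain ⟨p, -, hp⟩ := (hc.dvd_finsetProd_iff _).mp h
    exact hl3 p hp

lemma count_prime (hQ : Q.IsHomogeneous 2) (hG : G.IsHomogeneous 3) (hB : B.IsHomogeneous 4)
    {c : MvPolynomial (Fin 3) K} {n : ℕ} (hc : Prime c) (hch : c.IsHomogeneous n) (hcG : c ∣ G)
    (hcQB : c ∣ Q → ¬ c ∣ B) (W : Finset (Projectivization K (Fin 3 → K) × K))
    (hW : ∀ t z, (t, z) ∈ W ↔ SingAt Q G B t.rep z)
    (S : Finset (Projectivization K (Fin 3 → K) × K)) (hSW : S ⊆ W)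
    (hSc : ∀ s ∈ S, eval s.1.rep c = 0) : S.card ≤ 8 * n := by
  classical
  have hfib : ∀ t, (S.filter (fun s => s.1 = t)).card ≤ 1 + if eval t.rep Q = 0 then 1 else 0 := by
    intro t
    have e : (S.filter (fun s => s.1 = t)).card ≤ ((W.filter (fun s => s.1 = t)).image Prod.snd).card := by
      rw [Finset.card_image_of_injOn]
      · exact Finset.card_le_card (Finset.filter_subset_filter _ hSW)
      · intro a ha b hb hab
        simp at ha hb
        exact Prod.ext (ha.2.trans hb.2.symm) hab
    have hm : ∀ z, z ∈ ((W.filter (fun s => s.1 = t)).image Prod.snd) ↔ SingAt Q G B t.rep z := by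
      intro z
      rw [← hW]
      simp only [Finset.mem_image, Finset.mem_filter]
      constructor
      · rintro ⟨⟨t', z'⟩, ⟨h1, h2⟩, h3⟩
        simp only at h2 h3
        rw [← h2, ← h3]; exact h1
      · intro h
        exact ⟨(t, z), ⟨h, rfl⟩, rfl⟩
    split_ifs with h
    · exact e.trans (fiber_two _ hm)
    · exact e.trans (Finset.card_le_one.mpr fun a ha b hb =>
        fiber_one h ((hm a).mp ha) ((hm b).mp hb))
  obtain ⟨T, hT⟩ : ∃ T, T = S.image Prod.fst := ⟨_, rfl⟩
  have hTs : ∀ t ∈ T, ∃ z, SingAt Q G B t.rep z ∧ eval t.rep c = 0 := by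
    intro t ht
    rw [hT, Finset.mem_image] at ht
    obtain ⟨⟨t', z⟩, hs, rfl⟩ := ht
    exact ⟨z, (hW _ _).mp (hSW hs), hSc _ hs⟩
  have hTc : ∀ t ∈ T, eval t.rep c = 0 := fun t ht => (hTs t ht).choose_spec.2
  have hcard : S.card ≤ T.card + (T.filter (fun t => eval t.rep Q = 0)).card := by
    rw [Finset.card_eq_sum_card_image Prod.fst S, ← hT, Finset.card_filter, Finset.card_eq_sum_ones,
      ← Finset.sum_add_distrib]
    exact Finset.sum_le_sum fun t _ => hfib t
  by_cases hcQ : c ∣ Q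
  · have hQ0 : ∀ t ∈ T, eval t.rep Q = 0 := by
      intro t ht
      obtain ⟨q, rfl⟩ := hcQ
      rw [map_mul, hTc t ht, zero_mul]
    have hB0 : ∀ t ∈ T, eval t.rep B = 0 := by
      intro t ht
      obtain ⟨z, ⟨h1, h2, -⟩, -⟩ := hTs t ht
      rw [hQ0 t ht, h2] at h1
      linear_combination h1
    have h1 := bezout hch hB hc (hcQB hcQ) T hTc hB0
    have h2 := Finset.card_filter_le T (fun t => eval t.rep Q = 0)
    omega
  · obtain ⟨H, hH1, hH2⟩ := system (Q * B) G (hQ.mul hB) hG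
    have hex : ∃ j, ¬ c ∣ H j := by
      by_contra! hall
      obtain ⟨t, ht1, ht2, ht3⟩ := infinite_pts hc hch hQ hcQ (W.image Prod.fst)
      have hz : ∀ f, c ∣ f → eval t.rep f = 0 := by
        rintro _ ⟨q, rfl⟩
        rw [map_mul, ht2, zero_mul]
      obtain ⟨z, hz'⟩ := w_sing ht3 (hz _ hcG)
        ((hH2 t.rep t.rep_nonzero (hz _ hcG)).mpr fun j => hz _ (hall j))
      exact ht1 (Finset.mem_image.mpr ⟨(t, z), (hW _ _).mpr hz', rfl⟩)
    obtain ⟨j, hj⟩ := hex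
    obtain ⟨e, he, hHe⟩ := hH1 j
    have h1 := bezout hch hHe hc hj T hTc (by
      intro t ht
      obtain ⟨z, hz, -⟩ := hTs t ht
      exact (hH2 t.rep t.rep_nonzero hz.2.1).mp (sing_w hz) j)
    have h2 := bezout hch hQ hc hcQ (T.filter (fun t => eval t.rep Q = 0))
      (fun t ht => hTc t (Finset.mem_filter.mp ht).1) (fun t ht => (Finset.mem_filter.mp ht).2)
    have h3 : n * e ≤ n * 6 := Nat.mul_le_mul_left n he
    omega

lemma isUnit_of_hom_zero {c : MvPolynomial (Fin 3) K} (h : c.IsHomogeneous 0) (h0 : c ≠ 0) :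
    IsUnit c := by
  have e := totalDegree_eq_zero_iff_eq_C.mp ((totalDegree_zero_iff_isHomogeneous _).mpr h)
  rw [e] at h0 ⊢
  apply IsUnit.map
  rw [isUnit_iff_ne_zero]
  rintro h1
  rw [h1, C_0] at h0
  exact h0 rfl

lemma count_all (hQ : Q.IsHomogeneous 2) (hG : G.IsHomogeneous 3) (hB : B.IsHomogeneous 4)
    (hndvd : ∀ c, Prime c → c ∣ G → c ∣ Q → ¬ c ∣ B)
    (W : Finset (Projectivization K (Fin 3 → K) × K))
    (hW : ∀ t z, (t, z) ∈ W ↔ SingAt Q G B t.rep z) :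
    ∀ (n : ℕ) (A : MvPolynomial (Fin 3) K), A ≠ 0 → A.IsHomogeneous n → A ∣ G →
    ∀ S ⊆ W, (∀ s ∈ S, eval s.1.rep A = 0) → S.card ≤ 8 * n := by
  classical
  intro n
  induction n using Nat.strong_induction_on with
  | _ n ih =>
  intro A hA0 hA hAG S hSW hSA
  by_cases hu : IsUnit A
  · have : S = ∅ := by
      rw [Finset.eq_empty_iff_forall_notMem]
      intro s hs
      have := hu.map (eval s.1.rep)
      rw [hSA s hs] at this
      exact not_isUnit_zero this
    simp [this]
  · obtain ⟨c, hc, A', rfl⟩ := WfDvdMonoid.exists_irreducible_factor hu hA0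
    obtain ⟨a, b, ha, hb, rfl⟩ := hom_factor hA0 hA
    have ha0 : a ≠ 0 := by
      rintro rfl
      exact hc.not_isUnit (isUnit_of_hom_zero ha hc.ne_zero)
    have hcp : Prime c := hc.prime
    have hcG : c ∣ G := (dvd_mul_right _ _).trans hAG
    have h1 := count_prime hQ hG hB hcp ha hcG (hndvd c hcp hcG) W hW
      (S.filter (fun s => eval s.1.rep c = 0)) ((Finset.filter_subset _ _).trans hSW)
      (fun s hs => (Finset.mem_filter.mp hs).2)
    have h2 := ih b (by omega) A' (right_ne_zero_of_mul hA0) hb ((dvd_mul_left _ _).trans hAG)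
      (S.filter (fun s => ¬ eval s.1.rep c = 0)) ((Finset.filter_subset _ _).trans hSW) (by
        intro s hs
        obtain ⟨hs1, hs2⟩ := Finset.mem_filter.mp hs
        have := hSA s hs1
        rw [map_mul] at this
        exact (mul_eq_zero.mp this).resolve_left hs2)
    have h3 := Finset.card_filter_add_card_filter_not (s := S) (fun s => eval s.1.rep c = 0)
    omega

end plane

section space

variable {K : Type*} [Field K]

/-- The vector `(x, z)`. -/
def vec (x : Fin 3 → K) (z : K) : Fin 4 → K := ![x 0, x 1, x 2, z]

/-- The inclusion of the first three variables. -/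
abbrev iot : Fin 3 → Fin 4 := Fin.castLE (by norm_num : (3:ℕ) ≤ 4)

lemma iot_inj : Function.Injective iot := Fin.castLE_injective _

lemma iot_ne (i : Fin 3) : iot i ≠ 3 := by
  fin_cases i <;> decide

lemma vec_iot (x : Fin 3 → K) (z : K) : vec x z ∘ iot = x := by
  ext i
  fin_cases i <;> rfl

lemma vec_three (x : Fin 3 → K) (z : K) : vec x z 3 = z := rfl

lemma vec_smul (a : K) (x : Fin 3 → K) (z : K) : a • vec x z = vec (a • x) (a * z) := by
  ext i
  fin_cases i <;> rfl

lemma vec_inj {x y : Fin 3 → K} {z w : K} (h : vec x z = vec y w) : x = y ∧ z = w := by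
  constructor
  · rw [← vec_iot x z, h, vec_iot]
  · exact congrFun h 3

lemma vec_self (v : Fin 4 → K) : vec (v ∘ iot) (v 3) = v := by
  ext i
  fin_cases i <;> rfl

lemma vec_ne {x : Fin 3 → K} (hx : x ≠ 0) (z : K) : vec x z ≠ 0 := by
  intro h
  apply hx
  rw [← vec_iot x z, h]
  rfl

lemma eval_ren (x : Fin 3 → K) (z : K) (P : MvPolynomial (Fin 3) K) :
    eval (vec x z) (rename iot P) = eval x P := by
  rw [eval_rename, vec_iot]

lemma pd3_ren (P : MvPolynomial (Fin 3) K) : pderiv 3 (rename iot P) = 0 := by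
  classical
  apply pderiv_eq_zero_of_notMem_vars
  intro h
  obtain ⟨i, -, hi⟩ := Finset.mem_image.mp (vars_rename iot P h)
  exact iot_ne i hi

variable (Q G B : MvPolynomial (Fin 3) K)

/-- The quartic. -/
def quartic : MvPolynomial (Fin 4) K :=
  X 3 ^ 2 * rename iot Q + X 3 * rename iot G + rename iot B

lemma quartic_hom (hQ : Q.IsHomogeneous 2) (hG : G.IsHomogeneous 3) (hB : B.IsHomogeneous 4) :
    (quartic Q G B).IsHomogeneous 4 :=
  (((isHomogeneous_X_pow 3 2).mul hQ.rename_isHomogeneous).add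
    ((isHomogeneous_X _ 3).mul hG.rename_isHomogeneous)).add hB.rename_isHomogeneous

lemma pd3_quartic [CharP K 2] : pderiv 3 (quartic Q G B) = rename iot G := by
  have t : (2 : MvPolynomial (Fin 4) K) = 0 := CharTwo.two_eq_zero
  simp [quartic, Derivation.leibniz, Derivation.leibniz_pow, pd3_ren, t]

lemma pdi_quartic (i : Fin 3) : pderiv (iot i) (quartic Q G B) =
    quartic (pderiv i Q) (pderiv i G) (pderiv i B) := by
  have h : pderiv (iot i) (X 3 : MvPolynomial (Fin 4) K) = 0 :=
    pderiv_X_of_ne (iot_ne i).symm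
  simp only [quartic, Derivation.leibniz, Derivation.leibniz_pow, pderiv_rename iot_inj, h, map_add,
    smul_eq_mul, smul_zero, mul_zero, add_zero]

lemma eval_quartic (x : Fin 3 → K) (z : K) : eval (vec x z) (quartic Q G B) =
    z ^ 2 * eval x Q + z * eval x G + eval x B := by
  simp only [quartic, map_add, map_mul, map_pow, eval_X, eval_ren, vec_three]

lemma singAt_iff [CharP K 2] (x : Fin 3 → K) (z : K) :
    (eval (vec x z) (quartic Q G B) = 0 ∧ ∀ i, eval (vec x z) (pderiv i (quartic Q G B)) = 0) ↔
      SingAt Q G B x z := by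
  have h : (∀ i, eval (vec x z) (pderiv i (quartic Q G B)) = 0) ↔
      eval x G = 0 ∧ ∀ i, eval (vec x z) (pderiv (iot i) (quartic Q G B)) = 0 := by
    constructor
    · intro h
      refine ⟨?_, fun i => h _⟩
      rw [← eval_ren x z, ← pd3_quartic Q G B]
      exact h 3
    · rintro ⟨h1, h2⟩ i
      by_cases hi : i = 3
      · rw [hi, pd3_quartic, eval_ren, h1]
      · have : ∀ i : Fin 4, i ≠ 3 → ∃ j, iot j = i := by decide
        obtain ⟨j, rfl⟩ := this i hi
        exact h2 j
  rw [h]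
  simp only [pdi_quartic, eval_quartic, SingAt]

lemma mk_mem_iff [CharP K 2] (hQ : Q.IsHomogeneous 2) (hG : G.IsHomogeneous 3)
    (hB : B.IsHomogeneous 4) (x : Fin 3 → K) (z : K) (hv : vec x z ≠ 0) :
    Projectivization.mk K (vec x z) hv ∈ singLocus (quartic Q G B) ↔ SingAt Q G B x z := by
  rw [← singAt_iff]
  constructor
  · intro h
    exact h _ hv rfl
  · rintro ⟨h1, h2⟩ v hv' hvv
    obtain ⟨a, rfl⟩ := (Projectivization.mk_eq_mk_iff' K _ _ _ _).mp hvv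
    have hF := quartic_hom Q G B hQ hG hB
    refine ⟨?_, fun i => ?_⟩
    · rw [eval_smul_hom hF, h1, mul_zero]
    · rw [eval_smul_hom hF.pderiv, h2, mul_zero]

lemma not_common [CharP K 2] (hG0 : G ≠ 0) (hirr : Irreducible (quartic Q G B))
    (c : MvPolynomial (Fin 3) K) (hc : Prime c) (h1 : c ∣ G) (h2 : c ∣ Q) : ¬ c ∣ B := by
  rintro ⟨B', rfl⟩
  obtain ⟨G', rfl⟩ := h1
  obtain ⟨Q', rfl⟩ := h2
  have e : quartic (c * Q') (c * G') (c * B') = rename iot c * quartic Q' G' B' := by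
    simp only [quartic, map_mul]; ring
  rcases hirr.isUnit_or_isUnit e with h | h
  · apply hc.not_isUnit
    obtain ⟨k, hk, hk'⟩ := MvPolynomial.isUnit_iff_eq_C_of_isReduced.mp h
    have : c = C k := rename_injective _ iot_inj (by rw [hk', rename_C])
    rw [this]
    exact hk.map C
  · obtain ⟨k, hk, hk'⟩ := MvPolynomial.isUnit_iff_eq_C_of_isReduced.mp h
    have := pd3_quartic (c * Q') (c * G') (c * B')
    rw [e, hk'] at this
    simp only [Derivation.leibniz, pd3_ren, pderiv_C, smul_zero, add_zero] at this
    apply hG0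
    apply rename_injective _ iot_inj
    rw [← this, map_zero]

/-- Parametrization of the complement of `P`. -/
def par (tz : Projectivization K (Fin 3 → K) × K) : Projectivization K (Fin 4 → K) :=
  Projectivization.mk K (vec tz.1.rep tz.2) (vec_ne tz.1.rep_nonzero _)

lemma par_inj : Function.Injective (par (K := K)) := by
  rintro ⟨t, z⟩ ⟨t', z'⟩ h
  obtain ⟨a, ha⟩ := (Projectivization.mk_eq_mk_iff' K _ _ _ _).mp h
  simp only [vec_smul] at ha
  obtain ⟨h1, h2⟩ := vec_inj ha
  have ht : t = t' := by
    rw [← t.mk_rep, ← t'.mk_rep, Projectivization.mk_eq_mk_iff']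
    exact ⟨a, h1⟩
  subst ht
  have ha1 : a = 1 := by
    obtain ⟨i, hi⟩ := Function.ne_iff.mp t.rep_nonzero
    have := congrFun h1 i
    simp only [Pi.smul_apply, smul_eq_mul] at this
    exact mul_right_cancel₀ hi (by rw [this, one_mul])
  rw [ha1, one_mul] at h2
  rw [h2]

lemma par_surj (p : Projectivization K (Fin 4 → K))
    (hp : p ≠ Projectivization.mk K (vec 0 1) (fun h => one_ne_zero (congrFun h 3))) :
    ∃ tz, par tz = p := by
  induction p using Projectivization.ind with
  | h v hv =>
  obtain ⟨x, hx⟩ : ∃ x, x = v ∘ iot := ⟨_, rfl⟩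
  obtain ⟨z, hz⟩ : ∃ z, z = v 3 := ⟨_, rfl⟩
  have hvv : v = vec x z := by rw [hx, hz, vec_self]
  subst hvv
  by_cases hx0 : x = 0
  · exfalso
    apply hp
    rw [Projectivization.mk_eq_mk_iff']
    refine ⟨z, ?_⟩
    rw [vec_smul, hx0, smul_zero, mul_one]
  · obtain ⟨a, ha⟩ := Projectivization.exists_smul_eq_mk_rep K x hx0
    refine ⟨(Projectivization.mk K x hx0, a * z), ?_⟩
    rw [par, Projectivization.mk_eq_mk_iff']
    refine ⟨a, ?_⟩
    rw [vec_smul]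
    simp only [← ha, Units.smul_def]

end space

end SepQ

/-- Separable case: `K` algebraically closed of characteristic 2, `X = {F = 0} ⊆ ℙ³_K`
irreducible quartic with finite singular locus and a double point at `P = [0:0:0:1]`,
`F = z²Q(x) + zG(x) + B(x)` with `G ≢ 0` (the projection from `P` is separable).
Then `|Sing(X)| ≤ 25`. -/
theorem separable_projection_singular_count_le_twentyfive
    {K : Type*} [Field K] [IsAlgClosed K] [CharP K 2]
    (Q G B : MvPolynomial (Fin 3) K)
    (hQhom : Q.IsHomogeneous 2) (hQ0 : Q ≠ 0)
    (hGhom : G.IsHomogeneous 3) (hG0 : G ≠ 0)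
    (hBhom : B.IsHomogeneous 4)
    (F : MvPolynomial (Fin 4) K)
    (hF : F = X 3 ^ 2 * rename (Fin.castLE (by norm_num : (3:ℕ) ≤ 4)) Q
        + X 3 * rename (Fin.castLE (by norm_num : (3:ℕ) ≤ 4)) G
        + rename (Fin.castLE (by norm_num : (3:ℕ) ≤ 4)) B)
    (hFirr : Irreducible F) (hfin : (singLocus F).Finite) :
    (singLocus F).ncard ≤ 25 := by
  classical
  have hFq : F = SepQ.quartic Q G B := hF
  subst hFq
  obtain ⟨P, hP⟩ : ∃ P, P = Projectivization.mk K (SepQ.vec (0 : Fin 3 → K) 1)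
    (fun h => one_ne_zero (congrFun h 3)) := ⟨_, rfl⟩
  have hfin2 : (SepQ.par ⁻¹' singLocus (SepQ.quartic Q G B)).Finite :=
    hfin.preimage SepQ.par_inj.injOn
  obtain ⟨W, hWdef⟩ : ∃ W, W = hfin2.toFinset := ⟨_, rfl⟩
  have hW : ∀ t z, (t, z) ∈ W ↔ SepQ.SingAt Q G B t.rep z := by
    intro t z
    rw [hWdef, Set.Finite.mem_toFinset, Set.mem_preimage, SepQ.par,
      SepQ.mk_mem_iff Q G B hQhom hGhom hBhom]
  have hcount : W.card ≤ 8 * 3 :=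
    SepQ.count_all hQhom hGhom hBhom (SepQ.not_common Q G B hG0 hFirr) W hW 3 G hG0 hGhom
      dvd_rfl W (Finset.Subset.refl _) (fun s hs => ((hW s.1 s.2).mp hs).2.1)
  have hsub : singLocus (SepQ.quartic Q G B) ⊆ ((insert P (W.image SepQ.par) : Finset _) : Set _) := by
    intro p hp
    rw [Finset.coe_insert, Set.mem_insert_iff]
    by_cases h : p = P
    · exact Or.inl h
    · right
      obtain ⟨tz, rfl⟩ := SepQ.par_surj p (by rw [← hP]; exact h)
      rw [Finset.mem_coe, Finset.mem_image]
      exact ⟨tz, by rw [hWdef, Set.Finite.mem_toFinset]; exact hp, rfl⟩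
  calc (singLocus (SepQ.quartic Q G B)).ncard
      ≤ ((insert P (W.image SepQ.par) : Finset _) : Set _).ncard :=
        Set.ncard_le_ncard hsub (Finset.finite_toSet _)
    _ = (insert P (W.image SepQ.par)).card := Set.ncard_coe_finset _
    _ ≤ (W.image SepQ.par).card + 1 := Finset.card_insert_le _ _
    _ ≤ 25 := by
      have := Finset.card_image_le (s := W) (f := SepQ.par)
      omega

end
end
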